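/- (Cayley–Hamilton–Newton identity, symmetric form.) Let R̂ be a Hecke R-matrix for the parameter q with m_q ≠ 0 for all m ≥ 1, let F̂ be a closed R-matrix compatible with R̂, and let M be a matrix of generators of M(R̂,F̂) over a unital associative k-algebra A. Then for every k ≥ 1 the following identity of N×N matrices over A holds: k_q M^{S k} = Σ_{i=0}^{k−1} q^{−i} M^{‾(k−i)} τ_i(M). -/

import Mathlib

/-! Common definitions for quantum matrix algebras `M(R̂,F̂)` in the sense of
Isaev–Ogievetsky–Pyatov, "On quantum matrix algebras satisfying the
Cayley-Hamilton-Newton identities".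

We model operators on `V^{⊗m}` (where `dim V = N`) as matrices indexed by
multi-indices `Fin m → Fin N`; entries are taken in a (possibly
noncommutative) unital associative algebra `A` over a field `K`.
Sites (tensor factors) are numbered starting from `0`, so the paper's
`X_i` is `site m (i-1) X`, and the paper's `M_{\overline{k}}` is
`Mbar m F F⁻¹ M (k-1)`. -/

namespace CHN

noncomputable section

/-- Operators on `V^{⊗m}` (`dim V = N`) with entries in a ring `A`. -/
abbrev Op (N : ℕ) (A : Type*) [Ring A] (m : ℕ) :=
  Matrix (Fin m → Fin N) (Fin m → Fin N) A

/-- Operators on `V ⊗ V`. -/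
abbrev M2 (N : ℕ) (A : Type*) [Ring A] :=
  Matrix (Fin N × Fin N) (Fin N × Fin N) A

/-- `site m i X` places the two-site operator `X` at the (0-based) tensor
factors `i, i+1` of `V^{⊗m}`, acting as the identity elsewhere.  In the
paper's 1-based notation, `X_i = site m (i-1) X`.  (Out of range it is the
identity.) -/
def site {A : Type*} [Ring A] {N : ℕ} (m i : ℕ) (X : M2 N A) : Op N A m :=
  fun a b =>
    if h : i + 1 < m then
      X (a ⟨i, Nat.lt_of_succ_lt h⟩, a ⟨i + 1, h⟩)
          (b ⟨i, Nat.lt_of_succ_lt h⟩, b ⟨i + 1, h⟩) *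
        (if ∀ j : Fin m, (j : ℕ) ≠ i → (j : ℕ) ≠ i + 1 → a j = b j then 1 else 0)
    else if a = b then 1 else 0

/-- `site1 m i X` places the one-site operator `X` at the (0-based) factor `i`. -/
def site1 {A : Type*} [Ring A] {N : ℕ} (m i : ℕ) (X : Matrix (Fin N) (Fin N) A) :
    Op N A m :=
  fun a b =>
    if h : i < m then
      X (a ⟨i, h⟩) (b ⟨i, h⟩) *
        (if ∀ j : Fin m, (j : ℕ) ≠ i → a j = b j then 1 else 0)
    else if a = b then 1 else 0

/-- `chain m X i l = X_i X_{i+1} ⋯ X_{i+l-1}` (0-based sites, `l` factors); in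
the paper's 1-based notation this is `X_{i+1 → i+l}`. -/
def chain {A : Type*} [Ring A] {N : ℕ} (m : ℕ) (X : M2 N A) (i : ℕ) :
    ℕ → Op N A m
  | 0 => 1
  | l + 1 => chain m X i l * site m (i + l) X

/-- The Yang–Baxter equation `X₁X₂X₁ = X₂X₁X₂` on `V^{⊗3}`. -/
def YB {A : Type*} [Ring A] {N : ℕ} (X : M2 N A) : Prop :=
  site 3 0 X * site 3 1 X * site 3 0 X = site 3 1 X * site 3 0 X * site 3 1 X

/-- Compatibility of a pair of R-matrices: both Yang–Baxter equations together
with the conditions `R̂₁F̂₂F̂₁ = F̂₂F̂₁R̂₂` and `F̂₁F̂₂R̂₁ = R̂₂F̂₁F̂₂` on `V^{⊗3}`. -/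
def Compatible {A : Type*} [Ring A] {N : ℕ} (R F : M2 N A) : Prop :=
  YB R ∧ YB F ∧
    site 3 0 R * site 3 1 F * site 3 0 F = site 3 1 F * site 3 0 F * site 3 1 R ∧
    site 3 0 F * site 3 1 F * site 3 0 R = site 3 1 R * site 3 0 F * site 3 1 F

/-- `Ψ` witnesses closedness of `F̂`:  `Ψ^{af}_{cg} F̂^{gb}_{fd} = δ^a_d δ^b_c`. -/
def IsClosedPair {A : Type*} [Ring A] {N : ℕ} (F Ψ : M2 N A) : Prop :=
  ∀ a b c d : Fin N,
    (∑ f : Fin N, ∑ g : Fin N, Ψ (a, f) (c, g) * F (g, b) (f, d)) =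
      if a = d ∧ b = c then 1 else 0

/-- The matrix `D`, `D^a_b := Ψ^{ac}_{bc}`. -/
def Dmat {A : Type*} [Ring A] {N : ℕ} (Ψ : M2 N A) : Matrix (Fin N) (Fin N) A :=
  fun a b => ∑ c : Fin N, Ψ (a, c) (b, c)

/-- Quantum trace (with weight `D`) over the last tensor factor. -/
def qtr1 {K : Type*} [Field K] {A : Type*} [Ring A] [Algebra K A] {N m : ℕ}
    (D : Matrix (Fin N) (Fin N) K) (X : Op N A (m + 1)) : Op N A m :=
  fun a b => ∑ c : Fin N, ∑ e : Fin N,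
    algebraMap K A (D c e) * X (Fin.snoc a e) (Fin.snoc b c)

/-- Quantum trace over the last `j` tensor factors. -/
def qtrs {K : Type*} [Field K] {A : Type*} [Ring A] [Algebra K A] {N : ℕ}
    (D : Matrix (Fin N) (Fin N) K) (m : ℕ) :
    (j : ℕ) → Op N A (m + j) → Op N A m
  | 0, X => X
  | j + 1, X => qtrs D m j (qtr1 D X)

/-- Full quantum trace `Tr_F(1,…,m)`, with values in `A`. -/
def qtrAll {K : Type*} [Field K] {A : Type*} [Ring A] [Algebra K A] {N m : ℕ}
    (D : Matrix (Fin N) (Fin N) K) (X : Op N A m) : A :=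
  ∑ a : Fin m → Fin N, ∑ b : Fin m → Fin N,
    algebraMap K A (∏ i, D (a i) (b i)) * X b a

/-- Quantum trace of a one-site operator:  `Tr_F X = Tr (D X)`. -/
def trF {K : Type*} [Field K] {A : Type*} [Ring A] [Algebra K A] {N : ℕ}
    (D : Matrix (Fin N) (Fin N) K) (X : Matrix (Fin N) (Fin N) A) : A :=
  ∑ a : Fin N, ∑ b : Fin N, algebraMap K A (D a b) * X b a

/-- Ordinary partial trace over the last tensor factor. -/
def ptr1 {A : Type*} [Ring A] {N m : ℕ} (X : Op N A (m + 1)) : Op N A m :=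
  fun a b => ∑ c : Fin N, X (Fin.snoc a c) (Fin.snoc b c)

/-- Ordinary partial trace over the last `j` tensor factors. -/
def ptrs {A : Type*} [Ring A] {N : ℕ} (m : ℕ) :
    (j : ℕ) → Op N A (m + j) → Op N A m
  | 0, X => X
  | j + 1, X => ptrs m j (ptr1 X)

/-- `Mbar m F Finv M k` is the paper's `M_{\overline{k+1}}` (0-based index `k`):
`M_{\overline{1}} := M₁` and `M_{\overline{k+1}} := F̂_k M_{\overline{k}} F̂_k⁻¹`. -/
def Mbar {A : Type*} [Ring A] {N : ℕ} (m : ℕ) (F Finv : M2 N A)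
    (M : Matrix (Fin N) (Fin N) A) : ℕ → Op N A m
  | 0 => site1 m 0 M
  | k + 1 => site m k F * Mbar m F Finv M k * site m k Finv

/-- `MbarSeg m F Finv M i l = M_{\overline{i+1}} M_{\overline{i+2}} ⋯ M_{\overline{i+l}}`,
the ordered product of `l` consecutive copies starting at 0-based index `i`.
In particular `MbarSeg m F Finv M 0 k = M_{\overline{1}} ⋯ M_{\overline{k}}`. -/
def MbarSeg {A : Type*} [Ring A] {N : ℕ} (m : ℕ) (F Finv : M2 N A)
    (M : Matrix (Fin N) (Fin N) A) (i : ℕ) : ℕ → Op N A m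
  | 0 => 1
  | l + 1 => MbarSeg m F Finv M i l * Mbar m F Finv M (i + l)

/-- The double twist `R̂^{FF} = F̂ (F̂ R̂ F̂⁻¹) F̂⁻¹`. -/
def RFF {K : Type*} [Field K] {N : ℕ} (R F : M2 N K) : M2 N K :=
  F * (F * R * F⁻¹) * F⁻¹

/-- `M` is a matrix of generators of the algebra `M(R̂,F̂)`:
`R̂₁ M_{\overline{1}} M_{\overline{2}} = M_{\overline{1}} M_{\overline{2}} (R̂^{FF})₁`
on `V ⊗ V`. -/
def IsGenerators {K : Type*} [Field K] {A : Type*} [Ring A] [Algebra K A] {N : ℕ}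
    (R F : M2 N K) (M : Matrix (Fin N) (Fin N) A) : Prop :=
  site 2 0 (R.map (algebraMap K A)) *
      MbarSeg 2 (F.map (algebraMap K A)) ((F⁻¹).map (algebraMap K A)) M 0 2 =
    MbarSeg 2 (F.map (algebraMap K A)) ((F⁻¹).map (algebraMap K A)) M 0 2 *
      site 2 0 ((RFF R F).map (algebraMap K A))

/-- Evaluation of a noncommutative polynomial `Y` in `v` variables, substituting
for the variable `x_j` the operator `R̂` placed at the (0-based) sites
`p+j, p+j+1` of `V^{⊗m}`.  For `p = 0` this is the paper's
`Y^{(v+1)} = Y^{(v+1)}(R̂₁,…,R̂_v)`, and a general `p` gives `Y^{(p+1,v+1)}`. -/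
def evalY {K : Type*} [Field K] {A : Type*} [Ring A] [Algebra K A] {N m v : ℕ}
    (R : M2 N A) (p : ℕ) (Y : FreeAlgebra K (Fin v)) : Op N A m :=
  FreeAlgebra.lift K (fun j : Fin v => site m (p + (j : ℕ)) R) Y

/-- `Ustack m R k l = R̂_{l → l+k-1} ⋯ R̂_{2 → k+1} R̂_{1 → k}` (1-based labels):
the product of `l` descending chains of length `k`. -/
def Ustack {A : Type*} [Ring A] {N : ℕ} (m : ℕ) (R : M2 N A) (k : ℕ) :
    ℕ → Op N A m
  | 0 => 1
  | l + 1 => chain m R l k * Ustack m R k l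

/-- The `q`-number `n_q = (qⁿ − q⁻ⁿ)/(q − q⁻¹)`. -/
def qInt {K : Type*} [Field K] (q : K) (n : ℕ) : K :=
  (q ^ n - q⁻¹ ^ n) / (q - q⁻¹)

/-- `R̂` is a Hecke R-matrix for the parameter `q`:  it is invertible, satisfies
the Yang–Baxter equation and the Hecke condition `R̂² = 1 + (q − q⁻¹)R̂`. -/
def IsHecke {K : Type*} [Field K] {N : ℕ} (q : K) (R : M2 N K) : Prop :=
  IsUnit R ∧ YB R ∧ R * R = 1 + (q - q⁻¹) • R

/-- The `q`-antisymmetrizer `A^{(k)}` built from `R̂`, placed at the (0-based)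
tensor factors `p, p+1, …, p+k-1` of `V^{⊗m}`. -/
def qasym {K : Type*} [Field K] {N : ℕ} (q : K) (R : M2 N K) (m p : ℕ) :
    ℕ → Op N K m
  | 0 => 1
  | 1 => 1
  | k + 2 =>
      (qInt q (k + 2))⁻¹ •
        (qasym q R m p (k + 1) *
          (q ^ (k + 1) • (1 : Op N K m) - qInt q (k + 1) • site m (p + k) R) *
          qasym q R m p (k + 1))

/-- The `q`-symmetrizer `S^{(k)}` built from `R̂`, placed at the (0-based)
tensor factors `p, p+1, …, p+k-1` of `V^{⊗m}`. -/
def qsym {K : Type*} [Field K] {N : ℕ} (q : K) (R : M2 N K) (m p : ℕ) :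
    ℕ → Op N K m
  | 0 => 1
  | 1 => 1
  | k + 2 =>
      (qInt q (k + 2))⁻¹ •
        (qsym q R m p (k + 1) *
          (q⁻¹ ^ (k + 1) • (1 : Op N K m) + qInt q (k + 1) • site m (p + k) R) *
          qsym q R m p (k + 1))

/-- The elementary symmetric function
`σ_k(M) = Tr_F(1,…,k)(A^{(k)} M_{\overline{1}}⋯M_{\overline{k}})` (with `σ_0 = 1`). -/
def sigmaF {K : Type*} [Field K] {A : Type*} [Ring A] [Algebra K A] {N : ℕ}
    (q : K) (R F Ψ : M2 N K) (M : Matrix (Fin N) (Fin N) A) (k : ℕ) : A :=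
  qtrAll (Dmat Ψ)
    ((qasym q R k 0 k).map (algebraMap K A) *
      MbarSeg k (F.map (algebraMap K A)) ((F⁻¹).map (algebraMap K A)) M 0 k)

/-- The complete symmetric function
`τ_k(M) = Tr_F(1,…,k)(S^{(k)} M_{\overline{1}}⋯M_{\overline{k}})` (with `τ_0 = 1`). -/
def tauF {K : Type*} [Field K] {A : Type*} [Ring A] [Algebra K A] {N : ℕ}
    (q : K) (R F Ψ : M2 N K) (M : Matrix (Fin N) (Fin N) A) (k : ℕ) : A :=
  qtrAll (Dmat Ψ)
    ((qsym q R k 0 k).map (algebraMap K A) *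
      MbarSeg k (F.map (algebraMap K A)) ((F⁻¹).map (algebraMap K A)) M 0 k)

/-- The power sums `s_k(M) = Tr_F(1,…,k)(R̂_{1→k−1} M_{\overline{1}}⋯M_{\overline{k}})`,
with `s_0 = 1`. -/
def sF {K : Type*} [Field K] {A : Type*} [Ring A] [Algebra K A] {N : ℕ}
    (R F Ψ : M2 N K) (M : Matrix (Fin N) (Fin N) A) : ℕ → A
  | 0 => 1
  | j + 1 =>
      qtrAll (Dmat Ψ)
        (chain (j + 1) (R.map (algebraMap K A)) 0 j *
          MbarSeg (j + 1) (F.map (algebraMap K A)) ((F⁻¹).map (algebraMap K A)) M 0 (j + 1))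

/-- The `(j+1)`-st quantum power of `M`,
`M^{\overline{j+1}} = Tr_F(2,…,j+1)(R̂_{1→j} M_{\overline{1}}⋯M_{\overline{j+1}})`,
as a one-site operator (so `MpowF R F Ψ M 0 = M₁ = M`). -/
def MpowF {K : Type*} [Field K] {A : Type*} [Ring A] [Algebra K A] {N : ℕ}
    (R F Ψ : M2 N K) (M : Matrix (Fin N) (Fin N) A) (j : ℕ) : Op N A 1 :=
  qtrs (Dmat Ψ) 1 j
    (chain (1 + j) (R.map (algebraMap K A)) 0 j *
      MbarSeg (1 + j) (F.map (algebraMap K A)) ((F⁻¹).map (algebraMap K A)) M 0 (j + 1))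

/-- The `(j+1)`-st wedge power of `M`,
`M^{∧(j+1)} = Tr_F(2,…,j+1)(A^{(j+1)} M_{\overline{1}}⋯M_{\overline{j+1}})`. -/
def MwedgeF {K : Type*} [Field K] {A : Type*} [Ring A] [Algebra K A] {N : ℕ}
    (q : K) (R F Ψ : M2 N K) (M : Matrix (Fin N) (Fin N) A) (j : ℕ) : Op N A 1 :=
  qtrs (Dmat Ψ) 1 j
    ((qasym q R (1 + j) 0 (j + 1)).map (algebraMap K A) *
      MbarSeg (1 + j) (F.map (algebraMap K A)) ((F⁻¹).map (algebraMap K A)) M 0 (j + 1))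

/-- The `(j+1)`-st symmetric power of `M`,
`M^{S(j+1)} = Tr_F(2,…,j+1)(S^{(j+1)} M_{\overline{1}}⋯M_{\overline{j+1}})`. -/
def MsymF {K : Type*} [Field K] {A : Type*} [Ring A] [Algebra K A] {N : ℕ}
    (q : K) (R F Ψ : M2 N K) (M : Matrix (Fin N) (Fin N) A) (j : ℕ) : Op N A 1 :=
  qtrs (Dmat Ψ) 1 j
    ((qsym q R (1 + j) 0 (j + 1)).map (algebraMap K A) *
      MbarSeg (1 + j) (F.map (algebraMap K A)) ((F⁻¹).map (algebraMap K A)) M 0 (j + 1))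

/-- `M^{\overline{0}} := q^{-n} n_q Tr_{(2,…,n)}(A^{(n)}) D^{-1}`, with `n = n0 + 1`
(an ordinary, non-quantum, trace over the factors `2,…,n`). -/
def MzeroF {K : Type*} [Field K] {N : ℕ} (q : K) (R Ψ : M2 N K) (n0 : ℕ) :
    Op N K 1 :=
  (q⁻¹ ^ (n0 + 1) * qInt q (n0 + 1)) •
    (ptrs 1 n0 (qasym q R (1 + n0) 0 (n0 + 1)) * site1 1 0 ((Dmat Ψ)⁻¹))

/-- The generators of the characteristic subalgebra: all elements
`α(Y^{(k)}) = Tr_F(1,…,k)(Y^{(k)} M_{\overline{1}}⋯M_{\overline{k}})`, `k ≥ 1`. -/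
def charSet {K : Type*} [Field K] {A : Type*} [Ring A] [Algebra K A] {N : ℕ}
    (R F Ψ : M2 N K) (M : Matrix (Fin N) (Fin N) A) : Set A :=
  { x : A | ∃ (v : ℕ) (Y : FreeAlgebra K (Fin v)),
      x = qtrAll (Dmat Ψ)
        (evalY (R.map (algebraMap K A)) 0 Y *
          MbarSeg (v + 1) (F.map (algebraMap K A)) ((F⁻¹).map (algebraMap K A)) M 0 (v + 1)) }

end

section Embedding

variable {A : Type*} [Ring A] {N : ℕ}

/-- The operator `X` on `V^{⊗n}` placed at the tensor factors `e 0, …, e (n-1)` of `V^{⊗m}`. -/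
def emb {n m : ℕ} (e : Fin n → Fin m) (X : Op N A n) : Op N A m :=
  fun a b => X (a ∘ e) (b ∘ e) *
    if ∀ j, (∀ i, e i ≠ j) → a j = b j then 1 else 0

variable {n m k : ℕ}

lemma extend_eq_of_agree {e : Fin n → Fin m} (he : Function.Injective e) {a b : Fin m → Fin N}
    (h : ∀ j, (∀ i, e i ≠ j) → a j = b j) : Function.extend e (b ∘ e) a = b := by
  funext j
  by_cases hj : ∃ i, e i = j
  · obtain ⟨i, rfl⟩ := hj
    rw [he.extend_apply]; rfl
  · rw [Function.extend_apply' _ _ _ hj]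
    exact h j (not_exists.1 hj)

lemma extend_injective {e : Fin n → Fin m} (he : Function.Injective e) (a : Fin m → Fin N) :
    Function.Injective (fun c : Fin n → Fin N => Function.extend e c a) := by
  intro c d h
  funext i
  have := congrFun h (e i)
  simpa [he.extend_apply] using this

lemma emb_mul_apply {e : Fin n → Fin m} (he : Function.Injective e) (X : Op N A n)
    (Z : Op N A m) (a b : Fin m → Fin N) :
    (emb e X * Z) a b = ∑ c, X (a ∘ e) c * Z (Function.extend e c a) b := by
  rw [Matrix.mul_apply]
  symm
  refine Fintype.sum_of_injective (fun c => Function.extend e c a) (extend_injective he a) _ _ ?_ ?_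
  · intro c hc
    have : ¬ ∀ j, (∀ i, e i ≠ j) → a j = c j := fun h => hc ⟨c ∘ e, extend_eq_of_agree he h⟩
    simp [emb, this]
  · intro c
    have h1 : Function.extend e c a ∘ e = c := Function.extend_comp he _ _
    have h2 : ∀ j, (∀ i, e i ≠ j) → a j = Function.extend e c a j := fun j hj =>
      (Function.extend_apply' _ _ _ (not_exists.2 hj)).symm
    simp only [emb, h1, if_pos h2, mul_one]

lemma mul_emb_apply {e : Fin n → Fin m} (he : Function.Injective e) (X : Op N A n)
    (Z : Op N A m) (a b : Fin m → Fin N) :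
    (Z * emb e X) a b = ∑ c, Z a (Function.extend e c b) * X c (b ∘ e) := by
  rw [Matrix.mul_apply]
  symm
  refine Fintype.sum_of_injective (fun c => Function.extend e c b) (extend_injective he b) _ _ ?_ ?_
  · intro c hc
    have : ¬ ∀ j, (∀ i, e i ≠ j) → c j = b j :=
      fun h => hc ⟨c ∘ e, extend_eq_of_agree he fun j hj => (h j hj).symm⟩
    simp [emb, this]
  · intro c
    have h1 : Function.extend e c b ∘ e = c := Function.extend_comp he _ _
    have h2 : ∀ j, (∀ i, e i ≠ j) → Function.extend e c b j = b j := fun j hj =>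
      Function.extend_apply' _ _ _ (not_exists.2 hj)
    simp only [emb, h1, if_pos h2, mul_one]

lemma emb_one (e : Fin n → Fin m) : emb e (1 : Op N A n) = 1 := by
  ext a b
  simp only [emb, Matrix.one_apply, ← ite_and, mul_ite, mul_one, mul_zero]
  congr 1
  refine propext ⟨fun h => ?_, fun h => ⟨fun j _ => by rw [h], by rw [h]⟩⟩
  funext j
  by_cases hj : ∃ i, e i = j
  · obtain ⟨i, rfl⟩ := hj
    exact congrFun h.2 i
  · exact h.1 j (not_exists.1 hj)

lemma emb_mul {e : Fin n → Fin m} (he : Function.Injective e) (X Y : Op N A n) :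
    emb e (X * Y) = emb e X * emb e Y := by
  ext a b
  rw [emb_mul_apply he]
  simp only [emb, Matrix.mul_apply, Finset.sum_mul, Function.extend_comp he, mul_assoc]
  refine Finset.sum_congr rfl fun c _ => ?_
  congr 3
  refine propext (forall₂_congr fun j hj => ?_)
  rw [Function.extend_apply' _ _ _ (not_exists.2 hj)]

lemma emb_add (e : Fin n → Fin m) (X Y : Op N A n) : emb e (X + Y) = emb e X + emb e Y := by
  ext a b
  simp only [emb, Matrix.add_apply, add_mul]

lemma emb_smul {K : Type*} [Field K] [Algebra K A] (e : Fin n → Fin m) (c : K) (X : Op N A n) :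
    emb e (c • X) = c • emb e X := by
  ext a b
  simp [emb]

lemma emb_left_smul_one (e : Fin n → Fin m) (c : A) :
    emb e (c • (1 : Op N A n)) = c • (1 : Op N A m) := by
  rw [← emb_one e]
  ext a b
  simp only [emb, Matrix.smul_apply, smul_eq_mul, mul_assoc]

lemma emb_emb {f : Fin k → Fin n} {e : Fin n → Fin m} (he : Function.Injective e)
    (X : Op N A k) : emb e (emb f X) = emb (e ∘ f) X := by
  ext a b
  simp only [emb, mul_assoc, Function.comp_assoc]
  congr 1
  rw [mul_ite, mul_one, mul_zero, ← ite_and]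
  congr 1
  refine propext ⟨fun ⟨h2, h1⟩ j hj => ?_, fun h => ⟨fun j hj => ?_, fun j hj => ?_⟩⟩
  · by_cases hj' : ∃ i, e i = j
    · obtain ⟨i, rfl⟩ := hj'
      exact h1 i fun t ht => hj t (congrArg e ht)
    · exact h2 j (not_exists.1 hj')
  · exact h j fun t => hj (f t)
  · exact h (e j) fun t ht => hj t (he ht)

lemma emb_commute {e : Fin n → Fin m} {f : Fin k → Fin m} (he : Function.Injective e)
    (hef : ∀ i j, e i ≠ f j) (X : Op N A n) (Y : Op N A k)
    (hXY : ∀ a b c d, Commute (X a b) (Y c d)) : Commute (emb e X) (emb f Y) := by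
  have key : ∀ a b, (emb e X * emb f Y) a b =
      X (a ∘ e) (b ∘ e) * (Y (a ∘ f) (b ∘ f) *
        if ∀ j, (∀ i, e i ≠ j) → (∀ i, f i ≠ j) → a j = b j then 1 else 0) := by
    intro a b
    rw [emb_mul_apply he, Finset.sum_eq_single (b ∘ e)]
    · simp only [emb]
      congr 2
      · congr 1
        funext i
        exact Function.extend_apply' _ _ _ fun ⟨t, ht⟩ => hef t i ht
      · congr 1
        refine propext ⟨fun h j h1 h2 => ?_, fun h j h2 => ?_⟩
        · rw [← h j h2, Function.extend_apply' _ _ _ (not_exists.2 h1)]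
        · by_cases hj : ∃ i, e i = j
          · obtain ⟨i, rfl⟩ := hj
            rw [he.extend_apply]; rfl
          · rw [Function.extend_apply' _ _ _ hj]
            exact h j (not_exists.1 hj) h2
    · intro c _ hc
      have : ¬ ∀ j, (∀ i, f i ≠ j) → Function.extend e c a j = b j := by
        intro h
        apply hc
        funext i
        rw [← he.extend_apply c a i]
        exact h (e i) fun t ht => hef i t ht.symm
      simp [emb, this]
    · simp
  have key2 : ∀ a b, (emb f Y * emb e X) a b =
      (Y (a ∘ f) (b ∘ f) * X (a ∘ e) (b ∘ e)) *
        if ∀ j, (∀ i, e i ≠ j) → (∀ i, f i ≠ j) → a j = b j then 1 else 0 := by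
    intro a b
    rw [mul_emb_apply he, Finset.sum_eq_single (a ∘ e)]
    · have h1 : Function.extend e (a ∘ e) b ∘ f = b ∘ f := by
        funext i
        exact Function.extend_apply' _ _ _ fun ⟨t, ht⟩ => hef t i ht
      have h2 : (∀ j, (∀ i, f i ≠ j) → a j = Function.extend e (a ∘ e) b j) ↔
          ∀ j, (∀ i, e i ≠ j) → (∀ i, f i ≠ j) → a j = b j := by
        refine ⟨fun h j h1 h2 => ?_, fun h j h2 => ?_⟩
        · rw [h j h2, Function.extend_apply' _ _ _ (not_exists.2 h1)]
        · by_cases hj : ∃ i, e i = j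
          · obtain ⟨i, rfl⟩ := hj
            rw [he.extend_apply]; rfl
          · rw [Function.extend_apply' _ _ _ hj]
            exact h j (not_exists.1 hj) h2
      simp only [emb, h1, h2]
      split_ifs <;> simp
    · intro c _ hc
      have : ¬ ∀ j, (∀ i, f i ≠ j) → a j = Function.extend e c b j := by
        intro h
        apply hc
        funext i
        rw [← he.extend_apply c b i]
        exact (h (e i) fun t ht => hef i t ht.symm).symm
      simp [emb, this]
    · simp
  ext a b
  rw [key, key2, ← mul_assoc, (hXY _ _ _ _).eq]

end Embedding

section Sites

variable {A : Type*} [Ring A] {N n m k : ℕ}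

lemma site_eq_emb {i : ℕ} (h : i + 1 < m) (X : M2 N A) :
    site m i X = emb ![⟨i, Nat.lt_of_succ_lt h⟩, ⟨i + 1, h⟩] (site 2 0 X) := by
  ext a b
  simp only [site, emb, dif_pos h, Fin.forall_fin_two]
  simp [Fin.ext_iff, eq_comm]

lemma site1_eq_emb {i : ℕ} (h : i < m) (X : Matrix (Fin N) (Fin N) A) :
    site1 m i X = emb ![⟨i, h⟩] (site1 1 0 X) := by
  ext a b
  simp only [site1, emb, dif_pos h]
  simp [Fin.ext_iff, eq_comm]

lemma site_of_not_lt {i : ℕ} (h : ¬ i + 1 < m) (X : M2 N A) : site m i X = 1 := by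
  ext a b
  simp [site, h, Matrix.one_apply]

lemma pair_injective {i : ℕ} (h : i + 1 < m) :
    Function.Injective (![⟨i, Nat.lt_of_succ_lt h⟩, ⟨i + 1, h⟩] : Fin 2 → Fin m) := by
  intro s t
  fin_cases s <;> fin_cases t <;> simp

lemma emb_site {e : Fin n → Fin m} {i : ℕ} (he : ∀ t, (e t : ℕ) = i + t) {j : ℕ}
    (hj : j + 1 < n) (X : M2 N A) : emb e (site n j X) = site m (i + j) X := by
  have he' : Function.Injective e := fun s t hst => by
    have := he s; have := he t; rw [hst] at *; ext; omega
  have hm : i + j + 1 < m := by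
    have := he ⟨j + 1, hj⟩
    have h2 := (e ⟨j + 1, hj⟩).2
    simp only at this; omega
  rw [site_eq_emb hj, site_eq_emb hm, emb_emb he']
  congr 1
  funext t
  apply Fin.ext
  fin_cases t
  · simp [he]
  · simp [he, add_assoc]

lemma emb_site1 {e : Fin n → Fin m} {i : ℕ} (he : ∀ t, (e t : ℕ) = i + t) {j : ℕ}
    (hj : j < n) (X : Matrix (Fin N) (Fin N) A) :
    emb e (site1 n j X) = site1 m (i + j) X := by
  have he' : Function.Injective e := fun s t hst => by
    have := he s; have := he t; rw [hst] at *; ext; omega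
  have hm : i + j < m := by
    have := he ⟨j, hj⟩
    have h2 := (e ⟨j, hj⟩).2
    simp only at this; omega
  rw [site1_eq_emb hj, site1_eq_emb hm, emb_emb he']
  congr 1
  funext t
  apply Fin.ext
  fin_cases t
  simp [he]

lemma site_mul (m i : ℕ) (X Y : M2 N A) (h : i + 1 < m) :
    site m i (X * Y) = site m i X * site m i Y := by
  have h2 : site 2 0 (X * Y) = site 2 0 X * site 2 0 Y := by
    ext a b
    have : ∀ j : Fin 2, (j : ℕ) ≠ 0 → (j : ℕ) ≠ 0 + 1 → False := by
      intro j h1 h2; omega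
    have this' : ∀ {p : Fin 2 → Prop}, (∀ j : Fin 2, (j : ℕ) ≠ 0 → (j : ℕ) ≠ 0 + 1 → p j) :=
      fun j h1 h2 => (this j h1 h2).elim
    simp only [site, Matrix.mul_apply, if_pos this']
    simp only [zero_add, Nat.one_lt_ofNat, ↓reduceDIte, mul_one]
    exact (Equiv.sum_comp (finTwoArrowEquiv (Fin N))
      (fun p => X (a 0, a 1) p * Y p (b 0, b 1))).symm
  rw [site_eq_emb h, site_eq_emb h, site_eq_emb h, h2, emb_mul (pair_injective h)]

lemma site_one (m i : ℕ) : site m i (1 : M2 N A) = 1 := by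
  by_cases h : i + 1 < m
  · have h2 : site 2 0 (1 : M2 N A) = 1 := by
      ext a b
      simp [site, Matrix.one_apply, Fin.forall_fin_two, funext_iff]
    rw [site_eq_emb h, h2, emb_one]
  · exact site_of_not_lt h _

lemma site_add {i : ℕ} (h : i + 1 < m) (X Y : M2 N A) :
    site m i (X + Y) = site m i X + site m i Y := by
  ext a b
  simp only [site, dif_pos h, Matrix.add_apply, add_mul]

lemma site_smul {K : Type*} [Field K] [Algebra K A] {i : ℕ} (h : i + 1 < m) (c : K) (X : M2 N A) :
    site m i (c • X) = c • site m i X := by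
  ext a b
  simp only [site, dif_pos h, Matrix.smul_apply, smul_mul_assoc]

lemma site_map {B : Type*} [Ring B] (φ : A →+* B) (m i : ℕ) (X : M2 N A) :
    (site m i X).map φ = site m i (X.map φ) := by
  ext a b
  by_cases h : i + 1 < m <;> simp [site, h, apply_ite φ]

lemma site_commute {i j : ℕ} (hij : i + 2 ≤ j) (X Y : M2 N A)
    (hXY : ∀ a b c d, Commute (X a b) (Y c d)) : Commute (site m i X) (site m j Y) := by
  by_cases hj : j + 1 < m
  · have hi : i + 1 < m := by omega
    rw [site_eq_emb hi, site_eq_emb hj]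
    refine emb_commute (pair_injective hi) ?_ _ _ ?_
    · intro s t
      fin_cases s <;> fin_cases t <;> simp <;> omega
    · intro a b c d
      simp only [site, zero_add, Nat.one_lt_ofNat, ↓reduceDIte]
      refine Commute.mul_left (Commute.mul_right (hXY _ _ _ _) ?_) ?_ <;>
        split_ifs <;> simp
  · rw [site_of_not_lt hj]
    exact Commute.one_right _

lemma site1_commute {i j : ℕ} (hij : i + 1 ≤ j) (X : Matrix (Fin N) (Fin N) A) (Y : M2 N A)
    (hXY : ∀ a b c d, Commute (X a b) (Y c d)) : Commute (site1 m i X) (site m j Y) := by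
  by_cases hj : j + 1 < m
  · have hi : i < m := by omega
    rw [site1_eq_emb hi, site_eq_emb hj]
    refine emb_commute (fun _ _ _ => Subsingleton.elim _ _) ?_ _ _ ?_
    · intro s t
      fin_cases s; fin_cases t <;> simp <;> omega
    · intro a b c d
      simp only [site, site1, zero_add, Nat.one_lt_ofNat, Nat.lt_one_iff, ↓reduceDIte]
      refine Commute.mul_left (Commute.mul_right (hXY _ _ _ _) ?_) ?_ <;>
        split_ifs <;> simp
  · rw [site_of_not_lt hj]
    exact Commute.one_right _

/-- `X ⊗ I`, adding one tensor factor on the right. -/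
def up (X : Op N A m) : Op N A (m + 1) := emb Fin.castSucc X

lemma up_mul (X Y : Op N A m) : up (X * Y) = up X * up Y :=
  emb_mul (Fin.castSucc_injective m) X Y

lemma up_one : up (1 : Op N A m) = 1 := emb_one _

lemma up_site {i : ℕ} (h : i + 1 < m) (X : M2 N A) : up (site m i X) = site (m + 1) i X := by
  simpa [up] using emb_site (e := Fin.castSucc) (i := 0) (by simp) h X

lemma up_site1 {i : ℕ} (h : i < m) (X : Matrix (Fin N) (Fin N) A) :
    up (site1 m i X) = site1 (m + 1) i X := by
  simpa [up] using emb_site1 (e := Fin.castSucc) (i := 0) (by simp) h X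

lemma up_mul_snoc (X : Op N A m) (Z : Op N A (m + 1)) (a b : Fin m → Fin N) (x y : Fin N) :
    (up X * Z) (Fin.snoc a x) (Fin.snoc b y) = ∑ c, X a c * Z (Fin.snoc c x) (Fin.snoc b y) := by
  rw [up, emb_mul_apply (Fin.castSucc_injective m)]
  refine Finset.sum_congr rfl fun c _ => ?_
  congr 2
  · funext i; simp
  · refine Fin.lastCases ?_ (fun i => ?_) |> funext
    · rw [Function.extend_apply' _ _ _ (by simp [Fin.castSucc_ne_last])]; simp
    · rw [(Fin.castSucc_injective m).extend_apply]; simp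

lemma mul_up_snoc (X : Op N A m) (Z : Op N A (m + 1)) (a b : Fin m → Fin N) (x y : Fin N) :
    (Z * up X) (Fin.snoc a x) (Fin.snoc b y) = ∑ c, Z (Fin.snoc a x) (Fin.snoc c y) * X c b := by
  rw [up, mul_emb_apply (Fin.castSucc_injective m)]
  refine Finset.sum_congr rfl fun c _ => ?_
  congr 2
  · refine Fin.lastCases ?_ (fun i => ?_) |> funext
    · rw [Function.extend_apply' _ _ _ (by simp [Fin.castSucc_ne_last])]; simp
    · rw [(Fin.castSucc_injective m).extend_apply]; simp
  · funext i; simp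

lemma up_snoc (X : Op N A m) (a b : Fin m → Fin N) (x y : Fin N) :
    up X (Fin.snoc a x) (Fin.snoc b y) = if x = y then X a b else 0 := by
  have h : ∀ j : Fin (m + 1), (∀ i, Fin.castSucc i ≠ j) ↔ j = Fin.last m := by
    intro j
    refine Fin.lastCases ?_ (fun i => ?_) j
    · simp [Fin.castSucc_ne_last]
    · simp [Fin.castSucc_ne_last]
  have ha : (Fin.snoc a x : Fin (m + 1) → Fin N) ∘ Fin.castSucc = a := by funext i; simp
  have hb : (Fin.snoc b y : Fin (m + 1) → Fin N) ∘ Fin.castSucc = b := by funext i; simp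
  simp only [up, emb, h, forall_eq, ha, hb]
  simp

end Sites

section Trace

variable {K : Type*} [Field K] {A : Type*} [Ring A] [Algebra K A] {N m n k : ℕ}
  (D : Matrix (Fin N) (Fin N) K)

lemma qtr1_add (X Y : Op N A (m + 1)) : qtr1 D (X + Y) = qtr1 D X + qtr1 D Y := by
  ext a b
  simp [qtr1, mul_add, Finset.sum_add_distrib]

lemma qtr1_smul (c : K) (X : Op N A (m + 1)) : qtr1 D (c • X) = c • qtr1 D X := by
  ext a b
  simp [qtr1, Finset.smul_sum]

lemma qtr1_up_mul (X : Op N A m) (Y : Op N A (m + 1)) :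
    qtr1 D (up X * Y) = X * qtr1 D Y := by
  ext a b
  simp only [qtr1, up_mul_snoc]
  simp only [qtr1, Matrix.mul_apply, Finset.mul_sum]
  refine (Finset.sum_congr rfl fun c _ => Finset.sum_comm).trans ?_
  rw [Finset.sum_comm]
  refine Finset.sum_congr rfl fun c _ => ?_
  refine Finset.sum_congr rfl fun x _ => Finset.sum_congr rfl fun y _ => ?_
  rw [← mul_assoc, ← mul_assoc, (Algebra.commutes (D x y) (X a c))]

lemma qtr1_mul_up (X : Op N A m) (Y : Op N A (m + 1)) :
    qtr1 D (Y * up X) = qtr1 D Y * X := by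
  ext a b
  simp only [qtr1, mul_up_snoc]
  simp only [qtr1, Matrix.mul_apply, Finset.mul_sum, Finset.sum_mul]
  refine (Finset.sum_congr rfl fun c _ => Finset.sum_comm).trans ?_
  rw [Finset.sum_comm]
  refine Finset.sum_congr rfl fun c _ => ?_
  refine Finset.sum_congr rfl fun x _ => Finset.sum_congr rfl fun y _ => ?_
  rw [← mul_assoc]

lemma qtrAll_succ (X : Op N A (m + 1)) : qtrAll D X = qtrAll D (qtr1 D X) := by
  simp only [qtrAll, qtr1]
  rw [← (Fin.snocEquiv (fun _ : Fin (m + 1) => Fin N)).sum_comp, Fintype.sum_prod_type_right]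
  refine Finset.sum_congr rfl fun a _ => ?_
  simp_rw [← (Fin.snocEquiv (fun _ : Fin (m + 1) => Fin N)).sum_comp, Fintype.sum_prod_type_right]
  rw [Finset.sum_comm]
  refine Finset.sum_congr rfl fun b _ => ?_
  simp only [Finset.mul_sum]
  refine Finset.sum_congr rfl fun x _ => Finset.sum_congr rfl fun y _ => ?_
  simp [Fin.snocEquiv, Fin.prod_univ_castSucc, mul_assoc]

end Trace

section SiteAction

variable {A : Type*} [Ring A] {N m : ℕ}

lemma extend_pair {i : ℕ} (h : i + 1 < m) (c : Fin 2 → Fin N) (a : Fin m → Fin N) :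
    Function.extend ![⟨i, Nat.lt_of_succ_lt h⟩, ⟨i + 1, h⟩] c a =
      Function.update (Function.update a ⟨i, Nat.lt_of_succ_lt h⟩ (c 0)) ⟨i + 1, h⟩ (c 1) := by
  funext j
  by_cases h0 : j = ⟨i, Nat.lt_of_succ_lt h⟩
  · subst h0
    simpa [Function.update_of_ne] using
      (pair_injective h).extend_apply c a 0
  by_cases h1 : j = ⟨i + 1, h⟩
  · subst h1
    simpa using (pair_injective h).extend_apply c a 1
  · rw [Function.extend_apply', Function.update_of_ne h1, Function.update_of_ne h0]
    rintro ⟨t, rfl⟩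
    fin_cases t <;> simp_all

lemma site_mul_apply {i : ℕ} (h : i + 1 < m) (X : M2 N A) (Z : Op N A m) (a b : Fin m → Fin N) :
    (site m i X * Z) a b =
      ∑ p : Fin N × Fin N, X (a ⟨i, Nat.lt_of_succ_lt h⟩, a ⟨i + 1, h⟩) p *
        Z (Function.update (Function.update a ⟨i, Nat.lt_of_succ_lt h⟩ p.1) ⟨i + 1, h⟩ p.2) b := by
  rw [site_eq_emb h, emb_mul_apply (pair_injective h),
    ← (finTwoArrowEquiv (Fin N)).symm.sum_comp]
  refine Finset.sum_congr rfl fun p _ => ?_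
  rw [extend_pair h]
  have : ∀ j : Fin 2, (j : ℕ) ≠ 0 → (j : ℕ) ≠ 0 + 1 → False := by
    intro j h1 h2; omega
  have this' : ∀ {p : Fin 2 → Prop}, (∀ j : Fin 2, (j : ℕ) ≠ 0 → (j : ℕ) ≠ 0 + 1 → p j) :=
    fun j h1 h2 => (this j h1 h2).elim
  simp only [site, if_pos this']
  simp [finTwoArrowEquiv]

lemma mul_site_apply {i : ℕ} (h : i + 1 < m) (X : M2 N A) (Z : Op N A m) (a b : Fin m → Fin N) :
    (Z * site m i X) a b =
      ∑ p : Fin N × Fin N,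
        Z a (Function.update (Function.update b ⟨i, Nat.lt_of_succ_lt h⟩ p.1) ⟨i + 1, h⟩ p.2) *
        X p (b ⟨i, Nat.lt_of_succ_lt h⟩, b ⟨i + 1, h⟩) := by
  rw [site_eq_emb h, mul_emb_apply (pair_injective h),
    ← (finTwoArrowEquiv (Fin N)).symm.sum_comp]
  refine Finset.sum_congr rfl fun p _ => ?_
  rw [extend_pair h]
  have : ∀ j : Fin 2, (j : ℕ) ≠ 0 → (j : ℕ) ≠ 0 + 1 → False := by
    intro j h1 h2; omega
  have this' : ∀ {p : Fin 2 → Prop}, (∀ j : Fin 2, (j : ℕ) ≠ 0 → (j : ℕ) ≠ 0 + 1 → p j) :=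
    fun j h1 h2 => (this j h1 h2).elim
  simp only [site, if_pos this']
  simp [finTwoArrowEquiv]

/-- The multi-index `(a, x, y)`. -/
abbrev snoc2 (a : Fin m → Fin N) (x y : Fin N) : Fin (m + 2) → Fin N :=
  Fin.snoc (Fin.snoc a x : Fin (m + 1) → Fin N) y

lemma snoc2_penult (a : Fin m → Fin N) (x y : Fin N) (h : m < m + 2) :
    snoc2 a x y ⟨m, h⟩ = x := by
  have : (⟨m, h⟩ : Fin (m + 2)) = (Fin.last m).castSucc := rfl
  rw [snoc2, this, Fin.snoc_castSucc, Fin.snoc_last]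

lemma snoc2_last (a : Fin m → Fin N) (x y : Fin N) (h : m + 1 < m + 2) :
    snoc2 a x y ⟨m + 1, h⟩ = y := by
  have : (⟨m + 1, h⟩ : Fin (m + 2)) = Fin.last (m + 1) := rfl
  rw [snoc2, this, Fin.snoc_last]

lemma update_snoc2 (a : Fin m → Fin N) (x y p q : Fin N) (h : m < m + 2) (h' : m + 1 < m + 2) :
    Function.update (Function.update (snoc2 a x y) ⟨m, h⟩ p) ⟨m + 1, h'⟩ q = snoc2 a p q := by
  funext j
  refine Fin.lastCases ?_ (fun j => ?_) j
  · have : (⟨m + 1, h'⟩ : Fin (m + 2)) = Fin.last (m + 1) := rfl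
    rw [this, Function.update_self, snoc2, Fin.snoc_last]
  · rw [Function.update_of_ne (by simp [Fin.ext_iff]; omega)]
    refine Fin.lastCases ?_ (fun j => ?_) j
    · have : (⟨m, h⟩ : Fin (m + 2)) = (Fin.last m).castSucc := rfl
      rw [this, Function.update_self, snoc2, Fin.snoc_castSucc, Fin.snoc_last]
    · rw [Function.update_of_ne (by simp [Fin.ext_iff]; omega)]
      simp [snoc2]

lemma site_mul_snoc2 (X : M2 N A) (Z : Op N A (m + 2)) (a : Fin m → Fin N) (x y : Fin N)
    (b : Fin (m + 2) → Fin N) :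
    (site (m + 2) m X * Z) (snoc2 a x y) b =
      ∑ p : Fin N × Fin N, X (x, y) p * Z (snoc2 a p.1 p.2) b := by
  rw [site_mul_apply (by omega)]
  simp only [update_snoc2, snoc2_penult, snoc2_last]

lemma mul_site_snoc2 (X : M2 N A) (Z : Op N A (m + 2)) (b : Fin m → Fin N) (x y : Fin N)
    (a : Fin (m + 2) → Fin N) :
    (Z * site (m + 2) m X) a (snoc2 b x y) =
      ∑ p : Fin N × Fin N, Z a (snoc2 b p.1 p.2) * X p (x, y) := by
  rw [mul_site_apply (by omega)]
  simp only [update_snoc2, snoc2_penult, snoc2_last]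

end SiteAction

section DoubleTrace

variable {K : Type*} [Field K] {A : Type*} [Ring A] [Algebra K A] {N m : ℕ}

/-- The partial trace over the last two tensor factors with weight `W`. -/
def wtr (W : M2 N K) (X : Op N A (m + 2)) : Op N A m :=
  fun a b => ∑ p : Fin N × Fin N, ∑ r : Fin N × Fin N,
    algebraMap K A (W p r) * X (snoc2 a r.1 r.2) (snoc2 b p.1 p.2)

lemma qtr1_qtr1 (D : Matrix (Fin N) (Fin N) K) (X : Op N A (m + 2)) :
    qtr1 D (qtr1 D X) = wtr (Matrix.kroneckerMap (· * ·) D D) X := by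
  ext a b
  simp only [qtr1, wtr, Fintype.sum_prod_type, Finset.mul_sum, Matrix.kroneckerMap_apply, map_mul,
    mul_assoc]
  exact Finset.sum_congr rfl fun c _ => Finset.sum_comm

lemma wtr_mul_site (W U : M2 N K) (X : Op N A (m + 2)) :
    wtr W (X * site (m + 2) m (U.map (algebraMap K A))) = wtr (U * W) X := by
  ext a b
  simp only [wtr, mul_site_snoc2]
  simp only [Matrix.mul_apply, map_sum, Finset.sum_mul, Finset.mul_sum,
    Matrix.map_apply, map_mul]
  refine (Finset.sum_congr rfl fun c _ => Finset.sum_comm).trans ?_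
  rw [Finset.sum_comm]
  refine Finset.sum_congr rfl fun p _ => ?_
  rw [Finset.sum_comm]
  refine Finset.sum_congr rfl fun x _ => Finset.sum_congr rfl fun y _ => ?_
  rw [← mul_assoc, ← Algebra.commutes, mul_assoc]

lemma wtr_site_mul (W U : M2 N K) (X : Op N A (m + 2)) :
    wtr W (site (m + 2) m (U.map (algebraMap K A)) * X) = wtr (W * U) X := by
  ext a b
  simp only [wtr, site_mul_snoc2]
  simp only [Matrix.mul_apply, map_sum, Finset.sum_mul, Finset.mul_sum,
    Matrix.map_apply, map_mul, mul_assoc]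
  exact Finset.sum_congr rfl fun c _ => Finset.sum_comm

end DoubleTrace

section Closed

variable {K : Type*} [Field K] {N : ℕ} {F Ψ : M2 N K}

lemma IsClosedPair.symm (hΨ : IsClosedPair F Ψ) (f g f' g' : Fin N) :
    ∑ d : Fin N, ∑ b : Fin N, F (g, b) (f, d) * Ψ (d, f') (b, g') =
      if f = f' ∧ g = g' then 1 else 0 := by
  let P : M2 N K := .of fun x y => Ψ (x.1, y.1) (x.2, y.2)
  let Q : M2 N K := .of fun x y => F (x.2, y.2) (x.1, y.1)
  have hPQ : P * Q = 1 := by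
    ext ⟨a, c⟩ ⟨d, b⟩
    simp only [P, Q, Matrix.mul_apply, Matrix.of_apply, Fintype.sum_prod_type, hΨ a b c d,
      Matrix.one_apply, Prod.mk.injEq, eq_comm (a := b)]
  have hQP := mul_eq_one_comm.1 hPQ
  have := congrFun (congrFun hQP (f, g)) (f', g')
  simpa only [P, Q, Matrix.mul_apply, Matrix.of_apply, Fintype.sum_prod_type, Matrix.one_apply,
      Prod.mk.injEq] using this

lemma IsClosedPair.trace_eq (hΨ : IsClosedPair F Ψ) (a b : Fin N) :
    ∑ c : Fin N, ∑ e : Fin N, Dmat Ψ c e * F (a, e) (b, c) = if a = b then 1 else 0 := by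
  simp only [Dmat, Finset.sum_mul]
  calc _ = ∑ f, ∑ c, ∑ e, F (a, e) (b, c) * Ψ (c, f) (e, f) := by
        refine (Finset.sum_congr rfl fun c _ => Finset.sum_comm).trans ?_
        rw [Finset.sum_comm]
        simp only [mul_comm]
    _ = _ := by
        simp only [hΨ.symm, ite_and]
        simp

lemma IsClosedPair.cancel (hΨ : IsClosedPair F Ψ) {Z Z' : Fin N → Fin N → K}
    (h : ∀ g f, ∑ b, ∑ d, F (g, b) (f, d) * Z b d = ∑ b, ∑ d, F (g, b) (f, d) * Z' b d) :
    ∀ b d, Z b d = Z' b d := by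
  have key : ∀ (Z : Fin N → Fin N → K) (c a : Fin N),
      ∑ f, ∑ g, Ψ (a, f) (c, g) * ∑ b, ∑ d, F (g, b) (f, d) * Z b d = Z c a := by
    intro Z c a
    calc _ = ∑ b, ∑ d, (∑ f, ∑ g, Ψ (a, f) (c, g) * F (g, b) (f, d)) * Z b d := by
          simp only [Finset.mul_sum, Finset.sum_mul, ← mul_assoc]
          simp only [← Fintype.sum_prod_type']
          exact Fintype.sum_equiv ⟨fun x => (x.2.2.1, x.2.2.2, x.1, x.2.1),
            fun x => (x.2.2.1, x.2.2.2, x.1, x.2.1), fun _ => rfl, fun _ => rfl⟩ _ _ fun _ => rfl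
      _ = _ := by
          simp only [hΨ _ _ _ _, ite_and]
          simp
  intro b d
  rw [← key Z b d, ← key Z' b d]
  simp only [h]

end Closed

section ScalarSites

variable {K : Type*} [Field K] (A : Type*) [Ring A] [Algebra K A] {N : ℕ}

/-- A two-site operator with entries in `K`, viewed over `A`, placed at the sites `i, i+1`. -/
def ksite (m i : ℕ) (X : M2 N K) : Op N A m := site m i (X.map (algebraMap K A))

variable {A} {m i j : ℕ}

lemma ksite_eq_map (X : M2 N K) : ksite A m i X = (site m i X).map (algebraMap K A) :=
  (site_map _ _ _ _).symm

lemma ksite_self (X : M2 N K) : ksite K m i X = site m i X := by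
  rw [ksite_eq_map]; rfl

lemma ksite_mul (h : i + 1 < m) (X Y : M2 N K) :
    ksite A m i (X * Y) = ksite A m i X * ksite A m i Y := by
  rw [ksite_eq_map, site_mul _ _ _ _ h, Matrix.map_mul, ← ksite_eq_map, ← ksite_eq_map]

lemma ksite_one : ksite A m i (1 : M2 N K) = 1 := by
  rw [ksite_eq_map, site_one]
  exact Matrix.map_one _ (map_zero _) (map_one _)

lemma ksite_commute (h : i + 2 ≤ j ∨ j + 2 ≤ i) (X Y : M2 N K) :
    Commute (ksite A m i X) (ksite A m j Y) := by
  rcases h with h | h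
  · exact site_commute h _ _ fun a b c d => Algebra.commute_algebraMap_left _ _
  · exact (site_commute h _ _ fun a b c d => Algebra.commute_algebraMap_left _ _).symm

lemma up_ksite (h : i + 1 < m) (X : M2 N K) : up (ksite A m i X) = ksite A (m + 1) i X :=
  up_site h _

/-- Operators on `V^{⊗3}` placed at the sites `i, i+1, i+2`. -/
def shift3 (A : Type*) [Ring A] [Algebra K A] (h : i + 2 < m) : Op N K 3 →* Op N A m where
  toFun X := (emb (fun t : Fin 3 => (⟨i + t, by omega⟩ : Fin m)) X).map (algebraMap K A)
  map_one' := by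
    rw [emb_one]
    exact Matrix.map_one _ (map_zero _) (map_one _)
  map_mul' X Y := by
    rw [emb_mul (fun s t h => by simpa [Fin.ext_iff] using h), Matrix.map_mul]

lemma shift3_site (h : i + 2 < m) (hj : j + 1 < 3) (X : M2 N K) :
    shift3 A h (site 3 j X) = ksite A m (i + j) X := by
  rw [ksite_eq_map, ← emb_site (e := fun t : Fin 3 => ⟨i + t, by omega⟩) (fun _ => rfl) hj]
  rfl

variable {R F : M2 N K}

lemma YB.ksite (hR : YB R) (h : i + 2 < m) :
    ksite A m i R * ksite A m (i + 1) R * ksite A m i R =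
      ksite A m (i + 1) R * ksite A m i R * ksite A m (i + 1) R := by
  have e := congrArg (shift3 A h) (hR : site 3 0 R * _ * _ = _)
  have s0 := fun X : M2 N K => shift3_site (A := A) h (j := 0) (by decide) X
  have s1 := fun X : M2 N K => shift3_site (A := A) h (j := 1) (by decide) X
  simpa only [map_mul, s0, s1, add_zero] using e

lemma Compatible.ksite_left (hc : Compatible R F) (h : i + 2 < m) :
    ksite A m i F * ksite A m (i + 1) F * ksite A m i R =
      ksite A m (i + 1) R * (ksite A m i F * ksite A m (i + 1) F) := by
  have e := congrArg (shift3 A h) hc.2.2.2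
  have s0 := fun X : M2 N K => shift3_site (A := A) h (j := 0) (by decide) X
  have s1 := fun X : M2 N K => shift3_site (A := A) h (j := 1) (by decide) X
  simpa only [map_mul, s0, s1, add_zero, mul_assoc] using e

lemma Compatible.ksite_right (hc : Compatible R F) (h : i + 2 < m) :
    ksite A m i R * (ksite A m (i + 1) F * ksite A m i F) =
      ksite A m (i + 1) F * ksite A m i F * ksite A m (i + 1) R := by
  have e := congrArg (shift3 A h) hc.2.2.1
  have s0 := fun X : M2 N K => shift3_site (A := A) h (j := 0) (by decide) X
  have s1 := fun X : M2 N K => shift3_site (A := A) h (j := 1) (by decide) X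
  simpa only [map_mul, s0, s1, add_zero, mul_assoc] using e

lemma Compatible.self (hc : Compatible R F) : Compatible F F :=
  ⟨hc.2.1, hc.2.1, hc.2.1, hc.2.1⟩

lemma ksite_mul_inv (hF : IsUnit F) : ksite A m i F * ksite A m i F⁻¹ = 1 := by
  by_cases h : i + 1 < m
  · rw [← ksite_mul h, Matrix.mul_nonsing_inv _ ((Matrix.isUnit_iff_isUnit_det _).1 hF), ksite_one]
  · simp [ksite, site_of_not_lt h]

lemma ksite_inv_mul (hF : IsUnit F) : ksite A m i F⁻¹ * ksite A m i F = 1 := by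
  by_cases h : i + 1 < m
  · rw [← ksite_mul h, Matrix.nonsing_inv_mul _ ((Matrix.isUnit_iff_isUnit_det _).1 hF), ksite_one]
  · simp [ksite, site_of_not_lt h]

lemma Compatible.inv (hc : Compatible F F) (hF : IsUnit F) (h : i + 2 < m) :
    ksite A m i F * ksite A m (i + 1) F * ksite A m i F⁻¹ =
      ksite A m (i + 1) F⁻¹ * (ksite A m i F * ksite A m (i + 1) F) := by
  have h1 := hc.ksite_left (A := A) h
  calc _ = ksite A m (i + 1) F⁻¹ * (ksite A m (i + 1) F *
        (ksite A m i F * ksite A m (i + 1) F)) * ksite A m i F⁻¹ := by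
        rw [← mul_assoc (ksite A m (i + 1) F⁻¹), ksite_inv_mul hF, one_mul]
    _ = _ := by
        rw [← h1]
        simp only [mul_assoc]
        rw [ksite_mul_inv hF, mul_one]

lemma Compatible.inv' (hc : Compatible F F) (hF : IsUnit F) (h : i + 2 < m) :
    ksite A m i F⁻¹ * (ksite A m (i + 1) F * ksite A m i F) =
      ksite A m (i + 1) F * ksite A m i F * ksite A m (i + 1) F⁻¹ := by
  have h1 := hc.ksite_right (A := A) h
  calc _ = ksite A m i F⁻¹ * (ksite A m (i + 1) F * ksite A m i F * ksite A m (i + 1) F) *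
        ksite A m (i + 1) F⁻¹ := by
        simp only [mul_assoc]
        rw [ksite_mul_inv hF, mul_one]
    _ = _ := by
        rw [← h1, ← mul_assoc, ksite_inv_mul hF, one_mul]

lemma ksite_RFF (h : i + 1 < m) : ksite A m i (RFF R F) =
    ksite A m i F * (ksite A m i F * ksite A m i R * ksite A m i F⁻¹) * ksite A m i F⁻¹ := by
  simp only [RFF, ksite_mul h]

lemma Compatible.RFF_left (hc : Compatible R F) (hF : IsUnit F) (h : i + 2 < m) :
    ksite A m i F * ksite A m (i + 1) F * ksite A m i (RFF R F) =
      ksite A m (i + 1) (RFF R F) * (ksite A m i F * ksite A m (i + 1) F) := by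
  have a : SemiconjBy (ksite A m i F * ksite A m (i + 1) F) (ksite A m i R) (ksite A m (i + 1) R) :=
    hc.ksite_left h
  have b : SemiconjBy (ksite A m i F * ksite A m (i + 1) F) (ksite A m i F) (ksite A m (i + 1) F) :=
    hc.self.ksite_left h
  have c : SemiconjBy (ksite A m i F * ksite A m (i + 1) F) (ksite A m i F⁻¹)
    (ksite A m (i + 1) F⁻¹) := hc.self.inv hF h
  rw [ksite_RFF (by omega), ksite_RFF (by omega)]
  exact (b.mul_right ((b.mul_right a).mul_right c)).mul_right c

lemma Compatible.RFF_right (hc : Compatible R F) (hF : IsUnit F) (h : i + 2 < m) :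
    ksite A m i (RFF R F) * (ksite A m (i + 1) F * ksite A m i F) =
      ksite A m (i + 1) F * ksite A m i F * ksite A m (i + 1) (RFF R F) := by
  have a : SemiconjBy (ksite A m (i + 1) F * ksite A m i F) (ksite A m (i + 1) R) (ksite A m i R) :=
    (hc.ksite_right h).symm
  have b : SemiconjBy (ksite A m (i + 1) F * ksite A m i F) (ksite A m (i + 1) F) (ksite A m i F) :=
    (hc.self.ksite_right h).symm
  have c : SemiconjBy (ksite A m (i + 1) F * ksite A m i F) (ksite A m (i + 1) F⁻¹)
    (ksite A m i F⁻¹) := (hc.self.inv' hF h).symm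
  rw [ksite_RFF (by omega), ksite_RFF (by omega)]
  exact ((b.mul_right ((b.mul_right a).mul_right c)).mul_right c).eq.symm

end ScalarSites

section TraceLemmas

variable {K : Type*} [Field K] {A : Type*} [Ring A] [Algebra K A] {N m : ℕ} {R F Ψ : M2 N K}

lemma site_snoc2 (X : M2 N A) (a b : Fin m → Fin N) (x y z w : Fin N) :
    site (m + 2) m X (snoc2 a x y) (snoc2 b z w) = if a = b then X (x, y) (z, w) else 0 := by
  rw [← mul_one (site (m + 2) m X), site_mul_snoc2, ← up_one, ← up_one]
  simp only [up_snoc, snoc2, Fintype.sum_prod_type, Matrix.one_apply, mul_ite, mul_one, mul_zero]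
  simp

lemma IsClosedPair.qtr1_ksite (hΨ : IsClosedPair F Ψ) :
    qtr1 (Dmat Ψ) (ksite A (m + 2) m F) = 1 := by
  ext a b
  obtain ⟨a, x, rfl⟩ : ∃ a' x, a = (Fin.snoc a' x : Fin (m + 1) → Fin N) :=
    ⟨Fin.init a, a (Fin.last m), (Fin.snoc_init_self a).symm⟩
  obtain ⟨b, y, rfl⟩ : ∃ a' x, b = (Fin.snoc a' x : Fin (m + 1) → Fin N) :=
    ⟨Fin.init b, b (Fin.last m), (Fin.snoc_init_self b).symm⟩
  rw [← up_one, up_snoc]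
  simp only [qtr1, ksite]
  have := congrArg (algebraMap K A) (hΨ.trace_eq x y)
  simp only [map_sum, map_mul] at this
  simp only [site_snoc2, Matrix.map_apply, mul_ite, mul_zero]
  split_ifs <;> simp_all [Matrix.one_apply]

lemma IsClosedPair.twist_entry (hΨ : IsClosedPair F Ψ) (hc : Compatible F F) (hF : IsUnit F)
    (a b i k : Fin N) :
    ∑ c, ∑ e, ∑ j, Dmat Ψ c e * (F (a, e) (i, j) * F⁻¹ (k, j) (b, c)) =
      if a = b then Dmat Ψ k i else 0 := by
  revert i k
  apply hΨ.cancel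
  intro x y
  have h1 : qtr1 (Dmat Ψ) (ksite K 3 1 F * (up (ksite K 2 0 F) * ksite K 3 1 F⁻¹)) = 1 := by
    have h2 : ksite K 3 1 F * (up (ksite K 2 0 F) * ksite K 3 1 F⁻¹) =
        up (ksite K 2 0 F⁻¹) * (ksite K 3 1 F * up (ksite K 2 0 F)) := by
      rw [up_ksite (by omega), up_ksite (by omega), ← mul_assoc]
      exact (hc.inv' (i := 0) hF (by omega)).symm
    rw [h2, qtr1_up_mul, qtr1_mul_up, hΨ.qtr1_ksite, one_mul, ksite_inv_mul hF]
  have h3 := congrFun (congrFun h1 (snoc2 ![] x a)) (snoc2 ![] y b)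
  rw [← up_one, ← up_one] at h3
  simp only [ksite_self] at h3
  simp only [qtr1, up_snoc, snoc2] at h3
  have h4 : ∀ c e, (site 3 1 F * (up (site 2 0 F) * site 3 1 F⁻¹))
      (Fin.snoc (Fin.snoc (Fin.snoc ![] x : Fin 1 → Fin N) a : Fin 2 → Fin N) e)
      (Fin.snoc (Fin.snoc (Fin.snoc ![] y : Fin 1 → Fin N) b : Fin 2 → Fin N) c) =
      ∑ i, ∑ j, F (a, e) (i, j) * ∑ k, F (x, i) (y, k) * F⁻¹ (k, j) (b, c) := by
    intro c e
    refine (site_mul_snoc2 (m := 1) _ _ _ _ _ _).trans ?_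
    rw [Fintype.sum_prod_type]
    refine Finset.sum_congr rfl fun i _ => Finset.sum_congr rfl fun j _ => ?_
    congr 1
    refine (mul_site_snoc2 (m := 1) _ _ _ _ _ _).trans ?_
    rw [Fintype.sum_prod_type]
    refine Finset.sum_congr rfl fun k _ => ?_
    simp only [snoc2, up_snoc]
    simp only [ite_mul, zero_mul, Finset.sum_ite_eq, Finset.mem_univ, if_true]
    congr 1
    exact (site_snoc2 (m := 0) _ _ _ _ _ _ _).trans (if_pos rfl)
  simp only [h4] at h3
  have h5 : ∑ i, ∑ k, F (x, i) (y, k) * (if a = b then Dmat Ψ k i else 0) =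
      if a = b then if x = y then (1 : K) else 0 else 0 := by
    by_cases hab : a = b
    · simp only [hab, if_true, ← hΨ.trace_eq x y]
      rw [Finset.sum_comm]
      simp only [mul_comm]
    · simp [hab]
  rw [h5]
  refine Eq.trans ?_ (h3.trans (by simp))
  simp only [Finset.mul_sum, ← Fintype.sum_prod_type']
  refine Fintype.sum_equiv ⟨fun p => (p.2.2.1, p.2.2.2.1, p.1, p.2.2.2.2, p.2.1),
    fun p => (p.2.2.1, p.2.2.2.2, p.1, p.2.1, p.2.2.2.1), fun _ => rfl, fun _ => rfl⟩ _ _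
    fun p => ?_
  simp only [Equiv.coe_fn_mk, Algebra.algebraMap_self, RingHom.id_apply]
  ring

/-- The quantum trace is invariant under the conjugation by `F`. -/
lemma IsClosedPair.qtr1_conj (hΨ : IsClosedPair F Ψ) (hc : Compatible F F) (hF : IsUnit F)
    (X : Op N A (m + 1)) :
    qtr1 (Dmat Ψ) (ksite A (m + 2) m F * (up X * ksite A (m + 2) m F⁻¹)) =
      up (qtr1 (Dmat Ψ) X) := by
  ext a b
  obtain ⟨a, x, rfl⟩ : ∃ a' x, a = (Fin.snoc a' x : Fin (m + 1) → Fin N) :=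
    ⟨Fin.init a, a (Fin.last m), (Fin.snoc_init_self a).symm⟩
  obtain ⟨b, y, rfl⟩ : ∃ a' x, b = (Fin.snoc a' x : Fin (m + 1) → Fin N) :=
    ⟨Fin.init b, b (Fin.last m), (Fin.snoc_init_self b).symm⟩
  rw [up_snoc]
  have h4 : ∀ c e, (ksite A (m + 2) m F * (up X * ksite A (m + 2) m F⁻¹))
      (snoc2 a x e) (snoc2 b y c) =
      ∑ i, ∑ j, ∑ k, algebraMap K A (F (x, e) (i, j) * F⁻¹ (k, j) (y, c)) *
        X (Fin.snoc a i) (Fin.snoc b k) := by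
    intro c e
    rw [ksite, ksite, site_mul_snoc2, Fintype.sum_prod_type]
    refine Finset.sum_congr rfl fun i _ => Finset.sum_congr rfl fun j _ => ?_
    rw [mul_site_snoc2, Fintype.sum_prod_type, Finset.mul_sum]
    refine Finset.sum_congr rfl fun k _ => ?_
    simp only [snoc2, up_snoc]
    simp only [ite_mul, zero_mul, Finset.sum_ite_eq, Finset.mem_univ, if_true, Matrix.map_apply,
      map_mul, mul_assoc]
    rw [Algebra.commutes (F⁻¹ (k, j) (y, c)) (X _ _)]
  have h6 : (if x = y then qtr1 (Dmat Ψ) X a b else 0) =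
      ∑ k, ∑ i, algebraMap K A (if x = y then Dmat Ψ k i else 0) *
        X (Fin.snoc a i) (Fin.snoc b k) := by
    split_ifs <;> simp [qtr1]
  rw [h6]
  simp only [qtr1, h4, ← hΨ.twist_entry hc hF]
  simp only [map_sum, Finset.sum_mul, Finset.mul_sum, ← Fintype.sum_prod_type']
  refine Fintype.sum_equiv ⟨fun p => (p.2.2.2.2, p.2.2.1, p.1, p.2.1, p.2.2.2.1),
    fun p => (p.2.2.1, p.2.2.2.1, p.2.1, p.2.2.2.2, p.1), fun _ => rfl, fun _ => rfl⟩ _ _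
    fun p => ?_
  simp only [Equiv.coe_fn_mk, map_mul, mul_assoc]

end TraceLemmas

section DoubleTwist

variable {K : Type*} [Field K] {N : ℕ} {R F Ψ : M2 N K}

/-- The braiding of two pairs of strands. -/
def braid22 (F : M2 N K) : Op N K 4 :=
  ksite K 4 1 F * ksite K 4 0 F * (ksite K 4 2 F * ksite K 4 1 F)

lemma braid22_apply (F : M2 N K) (a b : Fin 4 → Fin N) :
    braid22 F a b = ∑ u, ∑ w, F (a 0, u) (b 0, w) *
      ∑ v, ∑ z, F (a 1, a 2) (u, v) * (F (v, a 3) (z, b 3) * F (w, z) (b 1, b 2)) := by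
  have hl : ∀ c : Fin 4 → Fin N, site 4 1 F c b =
      F (c 1, c 2) (b 1, b 2) * if c 0 = b 0 then if c 3 = b 3 then 1 else 0 else 0 := fun c => by
    simp [site, Fin.forall_fin_succ, ← ite_and]
  have h1 := fun (X : Op N K 4) c => site_mul_apply (m := 4) (i := 1) (by omega) F X c b
  have h0 := fun (X : Op N K 4) c => site_mul_apply (m := 4) (i := 0) (by omega) F X c b
  have h2 := fun (X : Op N K 4) c => site_mul_apply (m := 4) (i := 2) (by omega) F X c b
  simp only [braid22, ksite_self, mul_assoc, h1, h2, h0, hl, Fintype.sum_prod_type]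
  norm_num
  simp
  refine Finset.sum_congr rfl fun u _ => ?_
  simp only [Finset.mul_sum]
  rw [Finset.sum_comm]
  refine Finset.sum_congr rfl fun w _ => Finset.sum_congr rfl fun v _ =>
    Finset.sum_congr rfl fun z _ => ?_
  ring

lemma Compatible.site_mul_braid22 (hc : Compatible R F) :
    ksite K 4 2 R * braid22 F = braid22 F * ksite K 4 0 R := by
  have a : SemiconjBy (ksite K 4 0 F * ksite K 4 1 F) (ksite K 4 0 R) (ksite K 4 1 R) :=
    hc.ksite_left (by omega)
  have b : SemiconjBy (ksite K 4 1 F * ksite K 4 2 F) (ksite K 4 1 R) (ksite K 4 2 R) :=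
    hc.ksite_left (by omega)
  have c : braid22 F = (ksite K 4 1 F * ksite K 4 2 F) * (ksite K 4 0 F * ksite K 4 1 F) := by
    have := (ksite_commute (A := K) (m := 4) (i := 0) (j := 2) (by omega) F F).eq
    simp only [braid22, mul_assoc]
    rw [← mul_assoc (ksite K 4 0 F), this, mul_assoc]
  rw [c]
  exact (b.mul_left a).eq.symm

lemma Compatible.braid22_mul_site (hc : Compatible R F) (hF : IsUnit F) :
    braid22 F * ksite K 4 2 (RFF R F) = ksite K 4 0 (RFF R F) * braid22 F := by
  have a : SemiconjBy (ksite K 4 1 F * ksite K 4 0 F) (ksite K 4 1 (RFF R F))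
    (ksite K 4 0 (RFF R F)) := (hc.RFF_right hF (by omega)).symm
  have b : SemiconjBy (ksite K 4 2 F * ksite K 4 1 F) (ksite K 4 2 (RFF R F))
    (ksite K 4 1 (RFF R F)) := (hc.RFF_right hF (by omega)).symm
  exact (a.mul_left b).eq

lemma IsClosedPair.qtr1_qtr1_braid22 (hΨ : IsClosedPair F Ψ) (hF : YB F) :
    qtr1 (Dmat Ψ) (qtr1 (Dmat Ψ) (braid22 F)) = ksite K 2 0 F * ksite K 2 0 F := by
  have h1 : qtr1 (Dmat Ψ) (braid22 F) =
      up (ksite K 2 0 F) * (ksite K 3 1 F * up (ksite K 2 0 F)) := by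
    have : braid22 F = up (ksite K 3 1 F * ksite K 3 0 F) * (ksite K 4 2 F * up (ksite K 3 1 F)) := by
      rw [up_mul, up_ksite (by omega), up_ksite (by omega)]; rfl
    rw [this, qtr1_up_mul, qtr1_mul_up, hΨ.qtr1_ksite, one_mul, up_ksite (by omega), ← mul_assoc]
    exact (hF.ksite (by omega)).symm
  rw [h1, qtr1_up_mul, qtr1_mul_up, hΨ.qtr1_ksite, one_mul]

lemma IsClosedPair.wtr_braid22_injective (hΨ : IsClosedPair F Ψ) :
    Function.Injective fun W : M2 N K => wtr W (braid22 F) := by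
  intro W W' hW
  have h1 : ∀ (W : M2 N K) (x0 x1 y0 y1 : Fin N),
      wtr W (braid22 F) ![x0, x1] ![y0, y1] = ∑ u, ∑ w, F (x0, u) (y0, w) *
        ∑ x2, ∑ v, F (x1, x2) (u, v) * ∑ z, ∑ y2, F (w, z) (y1, y2) *
          ∑ x3, ∑ y3, F (v, x3) (z, y3) * W (y2, y3) (x2, x3) := by
    intro W x0 x1 y0 y1
    have e0 : ∀ (a b c d : Fin N), snoc2 ![a, b] c d 0 = a := fun _ _ _ _ => rfl
    have e1 : ∀ (a b c d : Fin N), snoc2 ![a, b] c d 1 = b := fun _ _ _ _ => rfl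
    have e2 : ∀ (a b c d : Fin N), snoc2 ![a, b] c d 2 = c := fun _ _ _ _ => rfl
    have e3 : ∀ (a b c d : Fin N), snoc2 ![a, b] c d 3 = d := fun _ _ _ _ => rfl
    simp only [wtr, braid22_apply, e0, e1, e2, e3]
    simp only [Finset.mul_sum, ← Fintype.sum_prod_type']
    refine Fintype.sum_equiv ⟨fun p => (p.2.2.1, p.2.2.2.1, p.2.1.1, p.2.2.2.2.1, p.2.2.2.2.2,
        p.1.1, p.2.1.2, p.1.2),
      fun p => ((p.2.2.2.2.2.1, p.2.2.2.2.2.2.2), (p.2.2.1, p.2.2.2.2.2.2.1), p.1, p.2.1,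
        p.2.2.2.1, p.2.2.2.2.1), fun _ => rfl, fun _ => rfl⟩ _ _ fun p => ?_
    simp only [Equiv.coe_fn_mk, Algebra.algebraMap_self, RingHom.id_apply]
    ring
  ext ⟨y2, y3⟩ ⟨x2, x3⟩
  refine hΨ.cancel (Z := fun x3 y3 => W (y2, y3) (x2, x3))
    (Z' := fun x3 y3 => W' (y2, y3) (x2, x3)) (fun v z => ?_) x3 y3
  revert z y2
  suffices ∀ w y1, _ from fun y2 z => hΨ.cancel this z y2
  intro w y1
  revert x2 v
  suffices ∀ x1 u, _ from fun x2 v => hΨ.cancel this x2 v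
  intro x1 u
  revert u w
  suffices ∀ x0 y0, _ from fun w u => hΨ.cancel this u w
  intro x0 y0
  have := congrFun (congrFun hW ![x0, x1]) ![y0, y1]
  simpa only [h1] using this

lemma IsClosedPair.kronecker_twist (hΨ : IsClosedPair F Ψ) (hc : Compatible R F) (hF : IsUnit F) :
    Matrix.kroneckerMap (· * ·) (Dmat Ψ) (Dmat Ψ) * R =
      RFF R F * Matrix.kroneckerMap (· * ·) (Dmat Ψ) (Dmat Ψ) := by
  apply hΨ.wtr_braid22_injective
  have h0 : ksite K 4 0 R = up (up (ksite K 2 0 R)) := by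
    rw [up_ksite (by omega), up_ksite (by omega)]
  have h0' : ksite K 4 0 (RFF R F) = up (up (ksite K 2 0 (RFF R F))) := by
    rw [up_ksite (by omega), up_ksite (by omega)]
  have h1 := congrArg (wtr (Matrix.kroneckerMap (· * ·) (Dmat Ψ) (Dmat Ψ))) hc.site_mul_braid22
  have h2 := congrArg (wtr (Matrix.kroneckerMap (· * ·) (Dmat Ψ) (Dmat Ψ)))
    (hc.braid22_mul_site hF)
  rw [ksite, wtr_site_mul, h0, ← qtr1_qtr1, qtr1_mul_up, qtr1_mul_up,
    hΨ.qtr1_qtr1_braid22 hc.2.1] at h1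
  rw [ksite, wtr_mul_site, h0', ← qtr1_qtr1, qtr1_up_mul, qtr1_up_mul,
    hΨ.qtr1_qtr1_braid22 hc.2.1] at h2
  simp only [h1, h2]
  have e : RFF R F * (F * F) = F * F * R := by
    have := Matrix.nonsing_inv_mul F ((Matrix.isUnit_iff_isUnit_det _).1 hF)
    have t : ∀ X : M2 N K, F⁻¹ * (F * X) = X := fun X => by rw [← mul_assoc, this, one_mul]
    simp only [RFF, mul_assoc, t, this, mul_one]
  simp only [← ksite_mul (A := K) (m := 2) (i := 0) (by omega), e]

/-- Cyclicity of the quantum trace over two adjacent factors. -/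
lemma IsClosedPair.qtr1_qtr1_mul_ksite {A : Type*} [Ring A] [Algebra K A] {m : ℕ}
    (hΨ : IsClosedPair F Ψ) (hc : Compatible R F) (hF : IsUnit F) (X : Op N A (m + 2)) :
    qtr1 (Dmat Ψ) (qtr1 (Dmat Ψ) (X * ksite A (m + 2) m (RFF R F))) =
      qtr1 (Dmat Ψ) (qtr1 (Dmat Ψ) (ksite A (m + 2) m R * X)) := by
  rw [qtr1_qtr1, qtr1_qtr1, ksite, ksite, wtr_mul_site, wtr_site_mul,
    hΨ.kronecker_twist hc hF]

end DoubleTwist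

section IteratedTrace

variable {K : Type*} [Field K] {A : Type*} [Ring A] [Algebra K A] {N n m l : ℕ}
  {D : Matrix (Fin N) (Fin N) K} {R F Ψ : M2 N K}

/-- The quantum trace over the tensor factors `n, …, m - 1`. -/
def dn (D : Matrix (Fin N) (Fin N) K) (h : n ≤ m) : Op N A m → Op N A n :=
  Nat.leRecOn (C := fun m => Op N A m → Op N A n) h (fun f X => f (qtr1 D X)) id

lemma dn_self (X : Op N A n) : dn D le_rfl X = X := by
  rw [dn, Nat.leRecOn_self]; rfl

lemma dn_succ (h : n ≤ m) (X : Op N A (m + 1)) :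
    dn D (h.trans m.le_succ) X = dn D h (qtr1 D X) := by
  rw [dn, Nat.leRecOn_succ h]; rfl

lemma dn_add (h : n ≤ m) (X Y : Op N A m) : dn D h (X + Y) = dn D h X + dn D h Y := by
  induction m, h using Nat.le_induction with
  | base => simp only [dn_self]
  | succ m h ih => rw [dn_succ h, dn_succ h, dn_succ h, qtr1_add, ih]

lemma dn_smul (h : n ≤ m) (c : K) (X : Op N A m) : dn D h (c • X) = c • dn D h X := by
  induction m, h using Nat.le_induction with
  | base => simp only [dn_self]
  | succ m h ih => rw [dn_succ h, dn_succ h, qtr1_smul, ih]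

lemma dn_dn (h : n ≤ m) (h' : m ≤ l) (X : Op N A l) :
    dn D h (dn D h' X) = dn D (h.trans h') X := by
  induction l, h' using Nat.le_induction with
  | base => rw [dn_self]
  | succ l h' ih => rw [dn_succ h', dn_succ (h.trans h'), ih]

lemma dn_mul_left (Z : ∀ k, Op N A k) (hZ : ∀ k, n ≤ k → up (Z k) = Z (k + 1)) (h : n ≤ m)
    (X : Op N A m) : dn D h (Z m * X) = Z n * dn D h X := by
  induction m, h using Nat.le_induction with
  | base => simp only [dn_self]
  | succ m h ih => rw [dn_succ h, dn_succ h, ← hZ m h, qtr1_up_mul, ih]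

lemma qtrs_eq_dn (j : ℕ) (X : Op N A (n + j)) :
    qtrs D n j X = dn D (Nat.le_add_right n j) X := by
  induction j with
  | zero => exact (dn_self X).symm
  | succ j ih => exact (ih _).trans (dn_succ (Nat.le_add_right n j) X).symm

lemma dn_zero (X : Op N A m) : dn D (Nat.zero_le m) X = qtrAll D X • (1 : Op N A 0) := by
  induction m with
  | zero =>
    rw [dn_self]
    ext a b
    simp [qtrAll, Subsingleton.elim a default, Subsingleton.elim b default]
  | succ m ih => rw [dn_succ (Nat.zero_le m), ih, qtrAll_succ]

/-- Cyclicity of the quantum trace. -/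
lemma IsClosedPair.dn_mul_ksite (hΨ : IsClosedPair F Ψ) (hc : Compatible R F) (hF : IsUnit F)
    {i : ℕ} (hn : n ≤ i) (hi : i + 1 < m) (X : Op N A m) :
    dn (Dmat Ψ) (by omega : n ≤ m) (X * ksite A m i (RFF R F)) =
      dn (Dmat Ψ) (by omega : n ≤ m) (ksite A m i R * X) := by
  obtain ⟨m, rfl⟩ : ∃ m', m = i + 2 + m' := ⟨m - (i + 2), by omega⟩
  induction m with
  | zero =>
    have := hΨ.qtr1_qtr1_mul_ksite hc hF (m := i) X
    have h2 : ∀ Z : Op N A (i + 2), dn (Dmat Ψ) (by omega : n ≤ i + 2) Z =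
        dn (Dmat Ψ) hn (qtr1 (Dmat Ψ) (qtr1 (Dmat Ψ) Z)) := fun Z => by
      rw [← dn_succ hn, ← dn_succ (by omega : n ≤ i + 1)]
    exact (h2 _).trans ((congrArg _ this).trans (h2 _).symm)
  | succ m ih =>
    have h2 : n ≤ i + 2 + m := by omega
    refine (dn_succ h2 _).trans (Eq.trans ?_ (dn_succ h2 _).symm)
    have e : ∀ U : M2 N K, ksite A (i + 2 + (m + 1)) i U = up (ksite A (i + 2 + m) i U) :=
      fun U => (up_ksite (by change i + 1 < i + 2 + m; omega) U).symm
    rw [e, e, qtr1_mul_up, qtr1_up_mul, ih (by omega)]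

/-- The inverse of a chain. -/
noncomputable def chainInv (m : ℕ) (F : M2 N K) (i : ℕ) : ℕ → Op N A m
  | 0 => 1
  | l + 1 => ksite A m (i + l) F⁻¹ * chainInv m F i l

/-- A chain of scalar operators. -/
def kchain (A : Type*) [Ring A] [Algebra K A] (m : ℕ) (F : M2 N K) (i l : ℕ) : Op N A m :=
  chain m (F.map (algebraMap K A)) i l

lemma kchain_zero (i : ℕ) : kchain A m F i 0 = 1 := rfl

lemma kchain_succ (i l : ℕ) :
    kchain A m F i (l + 1) = kchain A m F i l * ksite A m (i + l) F := rfl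

lemma kchain_mul_chainInv (hF : IsUnit F) (i l : ℕ) :
    kchain A m F i l * chainInv m F i l = 1 := by
  induction l with
  | zero => exact one_mul 1
  | succ l ih =>
    rw [kchain_succ, chainInv, mul_assoc, ← mul_assoc (ksite _ _ _ _), ksite_mul_inv hF, one_mul, ih]

lemma up_kchain {i : ℕ} (h : i + l < m) : up (kchain A m F i l) = kchain A (m + 1) F i l := by
  induction l with
  | zero => exact up_one
  | succ l ih => rw [kchain_succ, kchain_succ, up_mul, ih (by omega), up_ksite (by omega)]

lemma up_chainInv {i : ℕ} (h : i + l < m) :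
    up (chainInv m F i l : Op N A m) = chainInv (m + 1) F i l := by
  induction l with
  | zero => exact up_one
  | succ l ih => rw [chainInv, chainInv, up_mul, ih (by omega), up_ksite (by omega)]

lemma IsClosedPair.dn_conj (hΨ : IsClosedPair F Ψ) (hc : Compatible F F) (hF : IsUnit F)
    (h : n ≤ m) (X : Op N A m) :
    dn (Dmat Ψ) (Nat.succ_le_succ h)
        (kchain A (m + 1) F n (m - n) * (up X * chainInv (m + 1) F n (m - n))) =
      up (dn (Dmat Ψ) h X) := by
  induction m, h using Nat.le_induction with
  | base =>
    rw [Nat.sub_self, kchain_zero, one_mul, chainInv, mul_one, dn_self, dn_self]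
  | succ m h ih =>
    rw [dn_succ (Nat.succ_le_succ h), dn_succ h, ← ih, Nat.succ_sub h, kchain_succ, chainInv,
      Nat.add_sub_cancel' h, ← up_kchain (by omega), ← up_chainInv (by omega), ← hΨ.qtr1_conj hc hF,
      mul_assoc, qtr1_up_mul, ← mul_assoc (up X), ← mul_assoc (ksite _ _ _ F), qtr1_mul_up]

end IteratedTrace

lemma commute_conj {B : Type*} [Monoid B] {T T' x y c : B} (h : T * T' = 1) (h' : T' * T = 1)
    (hT : y * T = T * x) (hc : Commute x c) : Commute y (T * c * T') := by
  have hT1 : SemiconjBy T x y := hT.symm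
  have hT2 : SemiconjBy T' y x := by
    change T' * y = x * T'
    rw [← mul_one (T' * y), ← h, mul_assoc, ← mul_assoc y, hT, mul_assoc, ← mul_assoc T', h',
      one_mul]
  have hc1 : SemiconjBy c x x := hc.symm
  exact (((hT1.mul_left hc1).mul_left hT2).eq).symm

section Copies

variable {K : Type*} [Field K] {A : Type*} [Ring A] [Algebra K A] {N n m l i j k : ℕ}
  {R F Ψ X : M2 N K} {M : Matrix (Fin N) (Fin N) A}

/-- The copy of `M` at the factor `k`, with twists by a scalar matrix `F`. -/
noncomputable def copy (m : ℕ) (F : M2 N K) (M : Matrix (Fin N) (Fin N) A) (k : ℕ) : Op N A m :=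
  Mbar m (F.map (algebraMap K A)) (F⁻¹.map (algebraMap K A)) M k

/-- The product of `l` consecutive copies of `M`, starting at the factor `i`. -/
noncomputable def copies (m : ℕ) (F : M2 N K) (M : Matrix (Fin N) (Fin N) A) (i l : ℕ) :
    Op N A m :=
  MbarSeg m (F.map (algebraMap K A)) (F⁻¹.map (algebraMap K A)) M i l

lemma copy_succ : copy m F M (k + 1) = ksite A m k F * copy m F M k * ksite A m k F⁻¹ := rfl

lemma copies_zero : copies m F M i 0 = 1 := rfl

lemma copies_succ : copies m F M i (l + 1) = copies m F M i l * copy m F M (i + l) := rfl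

lemma copies_add (l l' : ℕ) :
    copies m F M i (l + l') = copies m F M i l * copies m F M (i + l) l' := by
  induction l' with
  | zero => rw [copies_zero, mul_one, add_zero]
  | succ l' ih => rw [← add_assoc, copies_succ, copies_succ, ih, mul_assoc, add_assoc]

lemma up_copy (h : k < m) : up (copy m F M k) = copy (m + 1) F M k := by
  induction k with
  | zero => exact up_site1 h M
  | succ k ih =>
    rw [copy_succ, copy_succ, up_mul, up_mul, ih (by omega), up_ksite h, up_ksite h]

lemma up_copies (h : i + l ≤ m) : up (copies m F M i l) = copies (m + 1) F M i l := by
  induction l with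
  | zero => exact up_one
  | succ l ih => rw [copies_succ, copies_succ, up_mul, ih (by omega), up_copy (by omega)]

lemma commute_copy_of_lt (h : k + 1 ≤ j) : Commute (ksite A m j X) (copy m F M k) := by
  induction k with
  | zero =>
    exact (site1_commute h _ _ fun a b c d => Algebra.commute_algebraMap_right _ _).symm
  | succ k ih =>
    rw [copy_succ]
    exact ((ksite_commute (by omega) _ _).mul_right (ih (by omega))).mul_right
      (ksite_commute (by omega) _ _)

lemma commute_copies_of_lt (h : i + l ≤ j) : Commute (ksite A m j X) (copies m F M i l) := by
  induction l with
  | zero => exact Commute.one_right _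
  | succ l ih => exact (ih (by omega)).mul_right (commute_copy_of_lt (by omega))

lemma copy_mul_ksite (hF : IsUnit F) :
    ksite A m k F * copy m F M k = copy m F M (k + 1) * ksite A m k F := by
  rw [copy_succ, mul_assoc, ksite_inv_mul hF, mul_one]

lemma commute_copy_of_gt (hF : IsUnit F) (h : j + 2 ≤ k) (hk : k < m)
    (hX : ksite A m j X * (ksite A m (j + 1) F * ksite A m j F) =
      ksite A m (j + 1) F * ksite A m j F * ksite A m (j + 1) X) :
    Commute (ksite A m j X) (copy m F M k) := by
  induction k, h using Nat.le_induction with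
  | base =>
    set T := ksite A m (j + 1) F * ksite A m j F with hT
    set T' := ksite A m j F⁻¹ * ksite A m (j + 1) F⁻¹ with hT'
    have hTT' : T * T' = 1 := by
      rw [hT, hT', mul_assoc, ← mul_assoc (ksite A m j F), ksite_mul_inv hF, one_mul,
        ksite_mul_inv hF]
    have hT'T : T' * T = 1 := by
      rw [hT, hT', mul_assoc, ← mul_assoc (ksite A m (j + 1) F⁻¹), ksite_inv_mul hF, one_mul,
        ksite_inv_mul hF]
    have e : copy m F M (j + 2) = T * copy m F M j * T' := by
      simp only [copy_succ, hT, hT', mul_assoc]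
    rw [e]
    exact commute_conj hTT' hT'T hX (commute_copy_of_lt le_rfl)
  | succ k h ih =>
    rw [copy_succ]
    exact ((ksite_commute (by omega) _ _).mul_right (ih (by omega))).mul_right
      (ksite_commute (by omega) _ _)

lemma commute_kchain (h : n + l < j) : Commute (ksite A m j X) (kchain A m F n l) := by
  induction l with
  | zero => exact Commute.one_right _
  | succ l ih => exact (ih (by omega)).mul_right (ksite_commute (by omega) _ _)

lemma Compatible.kchain_mul_ksite (hc : Compatible R F) (hm : n + l < m) (hj : n ≤ j)
    (hjl : j + 1 < n + l) :
    kchain A m F n l * ksite A m j R = ksite A m (j + 1) R * kchain A m F n l := by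
  induction l with
  | zero => omega
  | succ l ih =>
    rcases Nat.lt_or_ge (j + 1) (n + l) with h | h
    · rw [kchain_succ, mul_assoc, (ksite_commute (by omega) F R).eq, ← mul_assoc,
        ih (by omega) h, mul_assoc]
    · obtain ⟨l, rfl⟩ : ∃ l', l = l' + 1 := ⟨l - 1, by omega⟩
      obtain rfl : j = n + l := by omega
      rw [kchain_succ, kchain_succ, mul_assoc, mul_assoc, ← mul_assoc (ksite A m (n + l) F),
        ← add_assoc, hc.ksite_left (by omega), ← mul_assoc, ← mul_assoc, ← mul_assoc,
        ← (commute_kchain (n := n) (l := l) (by omega)).eq]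
      simp only [mul_assoc]

lemma kchain_mul_copy (hc : Compatible F F) (hF : IsUnit F) (hm : n + l < m) (hj : n ≤ j)
    (hjl : j < n + l) :
    kchain A m F n l * copy m F M j = copy m F M (j + 1) * kchain A m F n l := by
  have hk : ∀ {j l : ℕ}, j < m → n + l < j →
      Commute (kchain A m F n l) (copy m F M j) := fun {j l} hjm h => by
    induction l with
    | zero => exact Commute.one_left _
    | succ l ih =>
      exact (ih (by omega)).mul_left
        (commute_copy_of_gt hF (by omega) hjm (hc.ksite_right (by omega)))
  induction l with
  | zero => omega
  | succ l ih =>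
    rcases Nat.lt_or_ge j (n + l) with h | h
    · rw [kchain_succ, mul_assoc, (commute_copy_of_lt (by omega)).eq, ← mul_assoc,
        ih (by omega) h, mul_assoc]
    · obtain rfl : j = n + l := by omega
      rw [kchain_succ, mul_assoc, copy_mul_ksite hF, ← mul_assoc, (hk (by omega) (by omega)).eq,
        mul_assoc]

lemma kchain_mul_copies (hc : Compatible F F) (hF : IsUnit F) (hm : n + l < m) (hi : n ≤ i)
    (hk : i + k ≤ n + l) :
    kchain A m F n l * copies m F M i k = copies m F M (i + 1) k * kchain A m F n l := by
  induction k with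
  | zero => rw [copies_zero, copies_zero, mul_one, one_mul]
  | succ k ih =>
    rw [copies_succ, copies_succ, ← mul_assoc, ih (by omega), mul_assoc,
      kchain_mul_copy hc hF hm (by omega) (by omega), mul_assoc, add_right_comm]

lemma emb_copy {e : Fin n → Fin m} (he : ∀ t, (e t : ℕ) = t) (hk : k < n) :
    emb e (copy n F M k) = copy m F M k := by
  have he' : Function.Injective e := fun s t hst => by
    have := he s; have := he t; rw [hst] at *; ext; omega
  have he0 : ∀ t, (e t : ℕ) = 0 + t := fun t => by rw [he, zero_add]
  induction k with
  | zero => exact emb_site1 he0 hk M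
  | succ k ih =>
    rw [copy_succ, copy_succ, emb_mul he', emb_mul he', ih (by omega), ksite, ksite,
      emb_site he0 hk, emb_site he0 hk, zero_add]
    rfl

lemma IsGenerators.ksite_mul_copies_two (hM : IsGenerators R F M) (hc : Compatible R F)
    (hF : IsUnit F) (h : i + 1 < m) :
    ksite A m i R * copies m F M i 2 = copies m F M i 2 * ksite A m i (RFF R F) := by
  induction i with
  | zero =>
    have he0 : ∀ t : Fin 2, (Fin.castLE (by omega : 2 ≤ m) t : ℕ) = 0 + t := fun t => by simp
    have e := congrArg (emb (Fin.castLE (by omega : 2 ≤ m))) hM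
    have hi : Function.Injective (Fin.castLE (by omega : 2 ≤ m)) := Fin.castLE_injective _
    have e2 : emb (Fin.castLE (by omega : 2 ≤ m)) (copies 2 F M 0 2) = copies m F M 0 2 := by
      rw [copies_succ, copies_succ, copies_zero, emb_mul hi, emb_mul hi, emb_one,
        emb_copy (by simp) (by omega), emb_copy (by simp) (by omega)]
      rfl
    rw [emb_mul hi, emb_mul hi, emb_site he0 (by omega), emb_site he0 (by omega)] at e
    change _ * emb _ (copies 2 F M 0 2) = emb _ (copies 2 F M 0 2) * _ at e
    rwa [e2] at e
  | succ i ih =>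
    have ih := ih (by omega)
    set T := kchain A m F i 2 with hT
    have hTe : T = ksite A m i F * ksite A m (i + 1) F := by
      rw [hT, kchain_succ, kchain_succ, kchain_zero, one_mul, add_zero]
    have h1 : T * ksite A m i R = ksite A m (i + 1) R * T :=
      hc.kchain_mul_ksite (by omega) le_rfl (by omega)
    have h2 : T * copies m F M i 2 = copies m F M (i + 1) 2 * T :=
      kchain_mul_copies hc.self hF (by omega) le_rfl le_rfl
    have h3 : T * ksite A m i (RFF R F) = ksite A m (i + 1) (RFF R F) * T := by
      rw [hTe]
      exact hc.RFF_left hF (by omega)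
    have h4 : T * chainInv m F i 2 = 1 := kchain_mul_chainInv hF i 2
    have h5 : ksite A m (i + 1) R * copies m F M (i + 1) 2 * T =
        copies m F M (i + 1) 2 * ksite A m (i + 1) (RFF R F) * T := by
      rw [mul_assoc, ← h2, ← mul_assoc, ← h1, mul_assoc, ih, ← mul_assoc, h2, mul_assoc, h3,
        mul_assoc]
    simpa only [mul_assoc, h4, mul_one] using congrArg (· * (chainInv m F i 2 : Op N A m)) h5

lemma IsGenerators.ksite_mul_copies (hM : IsGenerators R F M) (hc : Compatible R F)
    (hF : IsUnit F) (h : i + 2 ≤ l) (hl : l ≤ m) :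
    ksite A m i R * copies m F M 0 l = copies m F M 0 l * ksite A m i (RFF R F) := by
  induction l, h using Nat.le_induction with
  | base =>
    have h1 : Commute (ksite A m i R) (copies m F M 0 i) := commute_copies_of_lt (by omega)
    have h2 := hM.ksite_mul_copies_two hc hF (m := m) (i := i) (by omega)
    rw [copies_add, zero_add, ← mul_assoc, h1.eq, mul_assoc, h2, mul_assoc]
  | succ l h ih =>
    have h1 : Commute (ksite A m i (RFF R F)) (copy m F M (0 + l)) :=
      commute_copy_of_gt hF (by omega) (by omega) (hc.RFF_right hF (by omega))
    rw [copies_succ, ← mul_assoc, ih (by omega), mul_assoc, h1.eq, mul_assoc]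

/-- Cyclicity of the quantum trace in presence of the full product of copies of `M`. -/
lemma IsGenerators.dn_mul_ksite_mul (hM : IsGenerators R F M) (hΨ : IsClosedPair F Ψ)
    (hc : Compatible R F) (hF : IsUnit F) (hn : n ≤ m) (hi : n ≤ i) (him : i + 1 < m)
    (X : Op N A m) :
    dn (Dmat Ψ) hn (X * ksite A m i R * copies m F M 0 m) =
      dn (Dmat Ψ) hn (ksite A m i R * X * copies m F M 0 m) := by
  rw [mul_assoc, hM.ksite_mul_copies hc hF (by omega) le_rfl, ← mul_assoc,
    hΨ.dn_mul_ksite hc hF hi him, mul_assoc]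

end Copies

section Symmetrizers

variable {K : Type*} [Field K] {B : Type*} [Ring B] [Algebra K B] {q : K} {g g' : ℕ → B} {k n : ℕ}

/-- The `q`-symmetrizers of a sequence of generators of the Hecke algebra. -/
noncomputable def sy (q : K) (g : ℕ → B) : ℕ → B
  | 0 => 1
  | 1 => 1
  | k + 2 => (qInt q (k + 2))⁻¹ •
      (sy q g (k + 1) * (q⁻¹ ^ (k + 1) • (1 : B) + qInt q (k + 1) • g k) * sy q g (k + 1))

/-- The first `n` terms of the sequence satisfy the relations of the Hecke algebra. -/
structure HeckeSeq (q : K) (g : ℕ → B) (n : ℕ) : Prop where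
  hecke : ∀ i < n, g i * g i = 1 + (q - q⁻¹) • g i
  braid : ∀ i, i + 1 < n → g i * g (i + 1) * g i = g (i + 1) * g i * g (i + 1)
  comm : ∀ i j, i + 2 ≤ j → j < n → Commute (g i) (g j)

lemma HeckeSeq.reverse (hg : HeckeSeq q g n) : HeckeSeq q (fun i => g (n - 1 - i)) n := by
  refine ⟨fun i hi => hg.hecke _ (by omega), fun i hi => ?_,
    fun i j hij hj => (hg.comm _ _ (by omega) (by omega)).symm⟩
  have := hg.braid (n - 1 - (i + 1)) (by omega)
  rw [show n - 1 - (i + 1) + 1 = n - 1 - i by omega] at this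
  exact this.symm

lemma HeckeSeq.tail (hg : HeckeSeq q g (n + 1)) : HeckeSeq q (fun i => g (i + 1)) n :=
  ⟨fun i hi => hg.hecke _ (by omega), fun i hi => hg.braid _ (by omega),
    fun i j hij hj => hg.comm _ _ (by omega) (by omega)⟩

lemma HeckeSeq.op (hg : HeckeSeq q g n) : HeckeSeq q (fun i => MulOpposite.op (g i)) n := by
  refine ⟨fun i hi => ?_, fun i hi => ?_, fun i j hij hj => (hg.comm i j hij hj).op⟩
  · rw [← MulOpposite.op_mul, hg.hecke i hi]; simp
  · simp only [← MulOpposite.op_mul, ← mul_assoc, hg.braid i hi]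

lemma sy_mem (S : Subalgebra K B) (h : ∀ i, i + 1 < k → g i ∈ S) : sy q g k ∈ S := by
  induction k using Nat.twoStepInduction with
  | zero => exact S.one_mem
  | one => exact S.one_mem
  | more k _ ih =>
    have := ih fun i hi => h i (by omega)
    exact S.smul_mem (S.mul_mem (S.mul_mem this (S.add_mem (S.smul_mem S.one_mem _)
      (S.smul_mem (h k (by omega)) _))) this) _

lemma sy_commute {x : B} (h : ∀ i, i + 1 < k → Commute x (g i)) : Commute x (sy q g k) := by
  have := sy_mem (q := q) (g := g) (k := k) (Subalgebra.centralizer K {x}) fun i hi =>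
    Subalgebra.mem_centralizer_iff _ |>.2 fun y hy => by rw [Set.mem_singleton_iff.1 hy, h i hi]
  exact Subalgebra.mem_centralizer_iff _ |>.1 this x rfl

lemma sy_congr (h : ∀ i, i + 1 < k → g i = g' i) : sy q g k = sy q g' k := by
  induction k using Nat.twoStepInduction with
  | zero => rfl
  | one => rfl
  | more k _ ih => rw [sy, sy, ih fun i hi => h i (by omega), h k (by omega)]

lemma sy_op : sy q (fun i => MulOpposite.op (g i)) k = MulOpposite.op (sy q g k) := by
  induction k using Nat.twoStepInduction with
  | zero => rfl
  | one => rfl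
  | more k _ ih => simp only [sy, ih, MulOpposite.op_smul, MulOpposite.op_mul, mul_assoc,
      MulOpposite.op_add, MulOpposite.op_one]

lemma qInt_one (hq0 : q ≠ 0) (hq1 : q ^ 2 ≠ 1) : qInt q 1 = 1 := by
  have : q - q⁻¹ ≠ 0 := fun h => hq1 (by field_simp at h; linear_combination h)
  rw [qInt, pow_one, pow_one, div_self this]

lemma qInt_succ (hq0 : q ≠ 0) (hq1 : q ^ 2 ≠ 1) (k : ℕ) :
    qInt q (k + 1) = q⁻¹ ^ k + q * qInt q k := by
  have : q - q⁻¹ ≠ 0 := fun h => hq1 (by field_simp at h; linear_combination h)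
  rw [qInt, qInt, mul_div_assoc', div_eq_iff this, add_mul, div_mul_cancel₀ _ this, pow_succ,
    pow_succ]
  ring

lemma absorb_step {a a' b b' : K} {S₁ S₂ x y : B} (hq0 : q ≠ 0) (ha : a' = q * a)
    (hS : b • S₁ = a' • S₂ + b' • (S₂ * y * S₂)) (hxS : x * S₂ = S₂ * x) (h21 : S₂ * S₁ = S₁)
    (hyS : y * S₁ = q • S₁) (hx : x * x = 1 + (q - q⁻¹) • x) (hb : y * x * y = x * y * x) :
    x * (a • S₁ + b • (S₁ * x * S₁)) = q • (a • S₁ + b • (S₁ * x * S₁)) := by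
  have e1 : b • (x * (S₁ * x * S₁)) =
      a' • (x * S₂ * x * S₁) + b' • (x * S₂ * y * S₂ * x * S₁) := by
    have := congrArg (fun Z => x * Z * x * S₁) hS
    simpa only [mul_add, add_mul, smul_mul_assoc, mul_smul_comm, mul_assoc] using this
  have e2 : x * S₂ * x * S₁ = S₁ + (q - q⁻¹) • (x * S₁) := by
    rw [mul_assoc x, ← hxS, ← mul_assoc, hx, mul_assoc, h21, add_mul, one_mul, smul_mul_assoc]
  have e3 : x * S₂ * y * S₂ * x * S₁ = q • (S₂ * y * S₂ * x * S₁) := by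
    calc _ = S₂ * (x * y * x) * (S₂ * S₁) := by
          rw [hxS]; simp only [mul_assoc]; rw [← mul_assoc S₂ x S₁, ← hxS, mul_assoc]
      _ = q • (S₂ * y * x * S₁) := by
          rw [← hb, h21, mul_assoc, mul_assoc _ y S₁, hyS]
          simp only [mul_smul_comm, mul_assoc]
      _ = _ := by
          congr 1
          simp only [mul_assoc]
          rw [← mul_assoc S₂ x S₁, ← hxS, mul_assoc x, h21]
  have e4 : b • (S₁ * x * S₁) = a' • (x * S₁) + b' • (S₂ * y * S₂ * x * S₁) := by
    have h : S₂ * (x * S₁) = x * S₁ := by rw [← mul_assoc, ← hxS, mul_assoc, h21]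
    have := congrArg (fun Z => Z * x * S₁) hS
    simp only [add_mul, smul_mul_assoc, mul_assoc, h] at this
    simpa only [mul_assoc, h] using this
  rw [mul_add, mul_smul_comm, mul_smul_comm, e1, e2, e3, smul_add q, e4, ha]
  match_scalars <;> field_simp
  ring


lemma sy_succ (hqn : ∀ n : ℕ, 1 ≤ n → qInt q n ≠ 0) (k : ℕ) :
    qInt q (k + 2) • sy q g (k + 2) =
      sy q g (k + 1) * (q⁻¹ ^ (k + 1) • (1 : B) + qInt q (k + 1) • g k) * sy q g (k + 1) := by
  rw [sy, smul_smul, mul_inv_cancel₀ (hqn _ (by omega)), one_smul]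

lemma sy_mul_of_absorb (hq0 : q ≠ 0) (hq1 : q ^ 2 ≠ 1) (hqn : ∀ n : ℕ, 1 ≤ n → qInt q n ≠ 0)
    {Z : B} (h : ∀ i, i + 1 < k → g i * Z = q • Z) : sy q g k * Z = Z := by
  induction k using Nat.twoStepInduction with
  | zero => exact one_mul Z
  | one => exact one_mul Z
  | more k _ ih =>
    have ih := ih fun i hi => h i (by omega)
    rw [sy, smul_mul_assoc, mul_assoc, ih, mul_assoc, add_mul, smul_mul_assoc, one_mul,
      smul_mul_assoc, h k (by omega), smul_smul, ← add_smul, mul_comm _ q, ← qInt_succ hq0 hq1,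
      mul_smul_comm, ih, smul_smul, inv_mul_cancel₀ (hqn _ (by omega)), one_smul]

lemma HeckeSeq.sy_absorb (hg : HeckeSeq q g n) (hq0 : q ≠ 0) (hq1 : q ^ 2 ≠ 1)
    (hqn : ∀ n : ℕ, 1 ≤ n → qInt q n ≠ 0) {i : ℕ} (hk : k ≤ n + 1) (hi : i + 1 < k) :
    g i * sy q g k = q • sy q g k := by
  induction k using Nat.strong_induction_on generalizing i with
  | _ k IH =>
  obtain ⟨k, rfl⟩ : ∃ k', k = k' + 2 := ⟨k - 2, by omega⟩
  have h1 : ∀ i, i + 1 < k + 1 → g i * sy q g (k + 1) = q • sy q g (k + 1) := fun i hi =>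
    IH (k + 1) (by omega) (by omega) hi
  rcases Nat.lt_or_ge i k with h | h
  · rw [sy, mul_smul_comm, mul_assoc, ← mul_assoc (g i), h1 i (by omega), smul_mul_assoc, smul_comm]
  obtain rfl : i = k := by omega
  have h11 := sy_mul_of_absorb hq0 hq1 hqn h1
  have key : g i * (q⁻¹ ^ (i + 1) • sy q g (i + 1) +
      qInt q (i + 1) • (sy q g (i + 1) * g i * sy q g (i + 1))) =
      q • (q⁻¹ ^ (i + 1) • sy q g (i + 1) +
        qInt q (i + 1) • (sy q g (i + 1) * g i * sy q g (i + 1))) := by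
    rcases i with _ | i
    · simp only [sy, zero_add, one_mul, mul_one, qInt_one hq0 hq1, one_smul, pow_one, mul_add,
        hg.hecke 0 (by omega), mul_smul_comm]
      match_scalars <;> field_simp
      ring
    · have h2 : ∀ j, j + 1 < i + 1 → g j * sy q g (i + 1) = q • sy q g (i + 1) := fun j hj =>
        IH (i + 1) (by omega) (by omega) hj
      refine absorb_step hq0 (a' := q⁻¹ ^ (i + 1)) (b' := qInt q (i + 1)) (S₂ := sy q g (i + 1))
        (y := g i) ?_ ?_ ?_ ?_ (h1 i (by omega)) (hg.hecke _ (by omega)) (hg.braid i (by omega))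
      · rw [pow_succ q⁻¹ (i + 1)]; field_simp
      · rw [sy_succ hqn, mul_add, add_mul, mul_smul_comm, smul_mul_assoc, mul_one,
          sy_mul_of_absorb hq0 hq1 hqn h2, mul_smul_comm, smul_mul_assoc]
      · exact sy_commute fun j hj => (hg.comm j _ (by omega) (by omega)).symm
      · exact sy_mul_of_absorb hq0 hq1 hqn fun j hj => h1 j (by omega)
  have e : sy q g (i + 2) = (qInt q (i + 2))⁻¹ • (q⁻¹ ^ (i + 1) • sy q g (i + 1) +
      qInt q (i + 1) • (sy q g (i + 1) * g i * sy q g (i + 1))) := by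
    rw [sy]
    simp only [mul_add, add_mul, mul_smul_comm, smul_mul_assoc, mul_one, h11]
  rw [e, mul_smul_comm, key, smul_comm]

lemma HeckeSeq.sy_absorb_right (hg : HeckeSeq q g n) (hq0 : q ≠ 0) (hq1 : q ^ 2 ≠ 1)
    (hqn : ∀ n : ℕ, 1 ≤ n → qInt q n ≠ 0) {i : ℕ} (hk : k ≤ n + 1) (hi : i + 1 < k) :
    sy q g k * g i = q • sy q g k := by
  have := hg.op.sy_absorb hq0 hq1 hqn hk hi
  rw [sy_op, ← MulOpposite.op_mul, ← MulOpposite.op_smul] at this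
  exact MulOpposite.op_injective this

lemma mul_sy_of_absorb (hq0 : q ≠ 0) (hq1 : q ^ 2 ≠ 1) (hqn : ∀ n : ℕ, 1 ≤ n → qInt q n ≠ 0)
    {Z : B} (h : ∀ i, i + 1 < k → Z * g i = q • Z) : Z * sy q g k = Z := by
  have := sy_mul_of_absorb hq0 hq1 hqn (g := fun i => MulOpposite.op (g i)) (k := k)
    (Z := MulOpposite.op Z) fun i hi => by rw [← MulOpposite.op_mul, h i hi, MulOpposite.op_smul]
  rw [sy_op, ← MulOpposite.op_mul] at this
  exact MulOpposite.op_injective this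

lemma HeckeSeq.sy_idem (hg : HeckeSeq q g n) (hq0 : q ≠ 0) (hq1 : q ^ 2 ≠ 1)
    (hqn : ∀ n : ℕ, 1 ≤ n → qInt q n ≠ 0) (hk : k ≤ n + 1) :
    sy q g k * sy q g k = sy q g k :=
  sy_mul_of_absorb hq0 hq1 hqn fun _ hi => hg.sy_absorb hq0 hq1 hqn hk hi

lemma HeckeSeq.sy_reverse (hg : HeckeSeq q g n) (hq0 : q ≠ 0) (hq1 : q ^ 2 ≠ 1)
    (hqn : ∀ n : ℕ, 1 ≤ n → qInt q n ≠ 0) :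
    sy q (fun i => g (n - 1 - i)) (n + 1) = sy q g (n + 1) := by
  have h1 : sy q g (n + 1) * sy q (fun i => g (n - 1 - i)) (n + 1) =
      sy q (fun i => g (n - 1 - i)) (n + 1) := by
    refine sy_mul_of_absorb hq0 hq1 hqn fun i hi => ?_
    have := hg.reverse.sy_absorb hq0 hq1 hqn le_rfl (i := n - 1 - i) (by omega)
    rwa [show n - 1 - (n - 1 - i) = i by omega] at this
  have h2 : sy q g (n + 1) * sy q (fun i => g (n - 1 - i)) (n + 1) = sy q g (n + 1) :=
    mul_sy_of_absorb hq0 hq1 hqn fun i hi =>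
      hg.sy_absorb_right hq0 hq1 hqn le_rfl (by omega)
  rw [← h1, h2]

/-- The recursion for the symmetrizers adding a generator at the beginning of the sequence. -/
lemma HeckeSeq.sy_succ_left (hg : HeckeSeq q g (n + 1)) (hq0 : q ≠ 0) (hq1 : q ^ 2 ≠ 1)
    (hqn : ∀ n : ℕ, 1 ≤ n → qInt q n ≠ 0) :
    qInt q (n + 2) • sy q g (n + 2) =
      sy q (fun i => g (i + 1)) (n + 1) * (q⁻¹ ^ (n + 1) • (1 : B) + qInt q (n + 1) • g 0) *
        sy q (fun i => g (i + 1)) (n + 1) := by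
  have h1 := hg.sy_reverse hq0 hq1 hqn
  have h2 : sy q (fun i => g (n + 1 - 1 - i)) (n + 1) = sy q (fun i => g (i + 1)) (n + 1) := by
    rw [← hg.tail.sy_reverse hq0 hq1 hqn]
    exact sy_congr fun i hi => by rw [show n + 1 - 1 - i = n - 1 - i + 1 by omega]
  rw [← h1, sy_succ hqn, h2]
  simp

end Symmetrizers

section Final

variable {K : Type*} [Field K] {A : Type*} [Ring A] [Algebra K A] {N n m l i j k p : ℕ} {q : K}
  {R F Ψ : M2 N K} {M : Matrix (Fin N) (Fin N) A}

lemma dn_mul_right {D : Matrix (Fin N) (Fin N) K} (c : A) (h : n ≤ m) (X : Op N A m) :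
    dn D h (X * (c • (1 : Op N A m))) = dn D h X * (c • (1 : Op N A n)) := by
  induction m, h using Nat.le_induction with
  | base => simp only [dn_self]
  | succ m h ih =>
    have e : (c • 1 : Op N A (m + 1)) = up (c • 1) := (emb_left_smul_one _ c).symm
    rw [dn_succ h, dn_succ h, e, qtr1_mul_up, ih]

lemma sy_semiconj {B : Type*} [Ring B] [Algebra K B] {g g' : ℕ → B} {T : B}
    (h : ∀ i, i + 1 < k → SemiconjBy T (g i) (g' i)) : SemiconjBy T (sy q g k) (sy q g' k) := by
  have hs : ∀ (c : K) {x y : B}, SemiconjBy T x y → SemiconjBy T (c • x) (c • y) :=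
    fun c x y h => by rw [SemiconjBy, mul_smul_comm, smul_mul_assoc, h.eq]
  induction k using Nat.twoStepInduction with
  | zero => exact SemiconjBy.one_right T
  | one => exact SemiconjBy.one_right T
  | more k _ ih =>
    have := ih fun i hi => h i (by omega)
    exact hs _ ((this.mul_right ((hs _ (SemiconjBy.one_right T)).add_right
      (hs _ (h k (by omega))))).mul_right this)

/-- The symmetrizer on the tensor factors `p, …, p + k - 1`. -/
noncomputable def ksym (A : Type*) [Ring A] [Algebra K A] (q : K) (R : M2 N K) (m p k : ℕ) :
    Op N A m :=
  sy q (fun i => ksite A m (p + i) R) k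

lemma map_smul_algebraMap {ι : Type*} (c : K) (X : Matrix ι ι K) :
    (c • X).map (algebraMap K A) = c • X.map (algebraMap K A) := by
  ext
  simp [Algebra.smul_def]

lemma qsym_map : (qsym q R m p k).map (algebraMap K A) = ksym A q R m p k := by
  have h1 : (1 : Op N K m).map (algebraMap K A) = 1 := Matrix.map_one _ (map_zero _) (map_one _)
  induction k using Nat.twoStepInduction with
  | zero => exact h1
  | one => exact h1
  | more k _ ih =>
    rw [ksym] at ih
    rw [qsym, ksym, sy, map_smul_algebraMap, Matrix.map_mul, Matrix.map_mul, ih,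
      Matrix.map_add _ (map_add _), map_smul_algebraMap, map_smul_algebraMap, h1, ksite_eq_map]

lemma IsHecke.heckeSeq (hH : IsHecke q R) (h : p + n < m) :
    HeckeSeq q (fun i => ksite A m (p + i) R) n := by
  refine ⟨fun i hi => ?_, fun i hi => hH.2.1.ksite (by omega),
    fun i j hij hj => ksite_commute (by omega) R R⟩
  have : ksite A m (p + i) (1 + (q - q⁻¹) • R) = 1 + (q - q⁻¹) • ksite A m (p + i) R := by
    rw [← ksite_one (K := K) (N := N) (i := p + i), ksite, Matrix.map_add _ (map_add _),
      site_add (by omega), map_smul_algebraMap, site_smul (by omega)]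
    rfl
  rw [← ksite_mul (by omega), hH.2.2, this]

lemma up_ksym (h : p + k ≤ m) : up (ksym A q R m p k) = ksym A q R (m + 1) p k := by
  induction k using Nat.twoStepInduction with
  | zero => exact up_one
  | one => exact up_one
  | more k _ ih =>
    have ih := ih (by omega)
    have hs : ∀ (c : K) (X : Op N A m), up (c • X) = c • up X := fun c X => emb_smul _ c X
    have ha : ∀ (X Y : Op N A m), up (X + Y) = up X + up Y := fun X Y => emb_add _ X Y
    rw [ksym] at ih ⊢
    rw [ksym] at ih ⊢
    rw [sy, sy, hs, up_mul, up_mul, ih, ha, hs, hs, up_one, up_ksite (by omega)]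

/-- The partial trace of the symmetrized product of the last copies of `M` is scalar. -/
lemma dn_ksym_mul_copies (hΨ : IsClosedPair F Ψ) (hc : Compatible R F) (hF : IsUnit F)
    (hm : n + i = m) :
    dn (Dmat Ψ) (by omega : n ≤ m) (ksym A q R m n i * copies m F M n i) =
      tauF q R F Ψ M i • (1 : Op N A n) := by
  subst hm
  induction n with
  | zero =>
    have h : ∀ m (hm : m = i), dn (Dmat Ψ) (Nat.zero_le m) (ksym A q R m 0 i * copies m F M 0 i) =
      tauF q R F Ψ M i • (1 : Op N A 0) := by
      rintro m rfl
      rw [dn_zero, tauF, qsym_map]; rfl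
    exact h _ (zero_add i)
  | succ n ih =>
    have h : ∀ m (hm : m = n + i + 1), dn (Dmat Ψ) (by omega : n + 1 ≤ m)
        (ksym A q R m (n + 1) i * copies m F M (n + 1) i) =
          tauF q R F Ψ M i • (1 : Op N A (n + 1)) := by
      rintro m rfl
      have h1 := hΨ.dn_conj hc.self hF (Nat.le_add_right n i)
        (ksym A q R (n + i) n i * copies (n + i) F M n i)
      have e : up (tauF q R F Ψ M i • (1 : Op N A n)) =
          tauF q R F Ψ M i • (1 : Op N A (n + 1)) := emb_left_smul_one _ _
      rw [ih, e, Nat.add_sub_cancel_left, up_mul, up_ksym le_rfl, up_copies le_rfl] at h1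
      have h2 : SemiconjBy (kchain A (n + i + 1) F n i) (ksym A q R (n + i + 1) n i)
          (ksym A q R (n + i + 1) (n + 1) i) := sy_semiconj fun t ht => by
        rw [add_right_comm n 1 t]
        exact hc.kchain_mul_ksite (by omega) (by omega) (by omega)
      rw [← h1, ← mul_assoc, ← mul_assoc, h2.eq, mul_assoc (ksym _ _ _ _ _ _),
        kchain_mul_copies hc.self hF (by omega) le_rfl le_rfl, mul_assoc, mul_assoc,
        kchain_mul_chainInv hF, mul_one]
    exact h _ (by omega)

lemma MpowF_eq (p : ℕ) : MpowF R F Ψ M p =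
    dn (Dmat Ψ) (Nat.le_add_right 1 p) (kchain A (1 + p) R 0 p * copies (1 + p) F M 0 (1 + p)) := by
  rw [MpowF, qtrs_eq_dn, add_comm p 1]; rfl

lemma MpowF_mul_tauF (hΨ : IsClosedPair F Ψ) (hc : Compatible R F) (hF : IsUnit F)
    (hm : 1 + p + i = m) :
    dn (Dmat Ψ) (by omega : 1 ≤ m)
        (kchain A m R 0 p * ksym A q R m (p + 1) i * copies m F M 0 m) =
      MpowF R F Ψ M p * (tauF q R F Ψ M i • (1 : Op N A 1)) := by
  have h1 : Commute (ksym A q R m (1 + p) i) (copies m F M 0 (1 + p)) :=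
    (sy_commute fun t ht => (commute_copies_of_lt (by omega)).symm).symm
  have h2 : copies m F M 0 m = copies m F M 0 (1 + p) * copies m F M (1 + p) i := by
    have := copies_add (A := A) (m := m) (F := F) (M := M) (i := 0) (1 + p) i
    rwa [hm, zero_add] at this
  rw [MpowF_eq, ← dn_mul_right, ← dn_ksym_mul_copies hΨ hc hF hm,
    ← dn_mul_left (fun k => kchain A k R 0 p * copies k F M 0 (1 + p)) (fun k hk => by
      rw [up_mul, up_kchain (by omega), up_copies (by omega)]), dn_dn, h2, add_comm p 1,
    mul_assoc (kchain A m R 0 p), ← mul_assoc (ksym _ _ _ _ _ _), h1.eq]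
  simp only [mul_assoc]

lemma IsGenerators.dn_mul_ksym_mul (hM : IsGenerators R F M) (hΨ : IsClosedPair F Ψ)
    (hc : Compatible R F) (hF : IsUnit F) (hn : n ≤ m) (hp : n ≤ p) (hpm : p + k ≤ m)
    (X : Op N A m) :
    dn (Dmat Ψ) hn (X * ksym A q R m p k * copies m F M 0 m) =
      dn (Dmat Ψ) hn (ksym A q R m p k * X * copies m F M 0 m) := by
  let S : Subalgebra K (Op N A m) :=
    { carrier := {Y | ∀ X, dn (Dmat Ψ) hn (X * Y * copies m F M 0 m) =
        dn (Dmat Ψ) hn (Y * X * copies m F M 0 m)}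
      mul_mem' := fun {Y Z} hY hZ X => by
        rw [← mul_assoc, hZ, ← mul_assoc, hY, ← mul_assoc]
      add_mem' := fun {Y Z} hY hZ X => by
        rw [mul_add, add_mul, dn_add, hY, hZ, ← dn_add, ← add_mul, ← add_mul]
      algebraMap_mem' := fun c X => by rw [Algebra.commutes] }
  exact sy_mem S (fun i hi => hM.dn_mul_ksite_mul hΨ hc hF hn (by omega) (by omega)) X

lemma cayleyHamiltonNewton_step (hq0 : q ≠ 0) (hq1 : q ^ 2 ≠ 1)
    (hqn : ∀ n : ℕ, 1 ≤ n → qInt q n ≠ 0) (hH : IsHecke q R) (hF : IsUnit F)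
    (hΨ : IsClosedPair F Ψ) (hc : Compatible R F) (hM : IsGenerators R F M) (hm : p + i + 2 = m) :
    qInt q (i + 2) • dn (Dmat Ψ) (by omega : 1 ≤ m)
        (kchain A m R 0 p * ksym A q R m p (i + 2) * copies m F M 0 m) =
      q⁻¹ ^ (i + 1) • (MpowF R F Ψ M p * (tauF q R F Ψ M (i + 1) • (1 : Op N A 1))) +
      qInt q (i + 1) • dn (Dmat Ψ) (by omega : 1 ≤ m)
        (kchain A m R 0 (p + 1) * ksym A q R m (p + 1) (i + 1) * copies m F M 0 m) := by
  set S := ksym A q R m (p + 1) (i + 1) with hS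
  have hS' : sy q (fun t => ksite A m (p + (t + 1)) R) (i + 1) = S :=
    sy_congr fun t _ => by rw [add_right_comm, add_assoc]
  have hrec : qInt q (i + 2) • ksym A q R m p (i + 2) =
      S * (q⁻¹ ^ (i + 1) • (1 : Op N A m) + qInt q (i + 1) • ksite A m p R) * S := by
    have := (hH.heckeSeq (A := A) (m := m) (p := p) (n := i + 1) (by omega)).sy_succ_left hq0 hq1 hqn
    rwa [hS', add_zero] at this
  have hidem : S * S = S :=
    (hH.heckeSeq (p := p + 1) (n := i) (by omega)).sy_idem hq0 hq1 hqn le_rfl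
  have hcomm : Commute (kchain A m R 0 p) S :=
    sy_commute fun t ht => (commute_kchain (by omega)).symm
  have hcyc : dn (Dmat Ψ) (by omega : 1 ≤ m)
        (kchain A m R 0 p * (S * ksite A m p R * S) * copies m F M 0 m) =
      dn (Dmat Ψ) (by omega : 1 ≤ m) (kchain A m R 0 (p + 1) * S * copies m F M 0 m) := by
    have := hM.dn_mul_ksym_mul (q := q) hΨ hc hF (by omega : 1 ≤ m) (p := p + 1) (k := i + 1)
      (by omega) (by omega) (kchain A m R 0 (p + 1) * S)
    rw [← hS, mul_assoc _ S S, hidem] at this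
    rw [this, kchain_succ, zero_add, ← mul_assoc, ← mul_assoc, ← mul_assoc, ← mul_assoc, hcomm.eq]
  rw [← dn_smul, ← smul_mul_assoc, ← mul_smul_comm, hrec, ← hcyc, ← MpowF_mul_tauF hΨ hc hF
    (by omega : 1 + p + (i + 1) = m), ← hS, ← dn_smul, ← dn_smul, ← dn_add]
  congr 1
  simp only [mul_add, add_mul, mul_smul_comm, smul_mul_assoc, mul_one, hidem]

lemma cayleyHamiltonNewton_sum (hq0 : q ≠ 0) (hq1 : q ^ 2 ≠ 1)
    (hqn : ∀ n : ℕ, 1 ≤ n → qInt q n ≠ 0) (hH : IsHecke q R) (hF : IsUnit F)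
    (hΨ : IsClosedPair F Ψ) (hc : Compatible R F) (hM : IsGenerators R F M) (hm : p + i + 1 = m) :
    qInt q (i + 1) • dn (Dmat Ψ) (by omega : 1 ≤ m)
        (kchain A m R 0 p * ksym A q R m p (i + 1) * copies m F M 0 m) =
      ∑ t ∈ Finset.range (i + 1), q⁻¹ ^ t •
        (MpowF R F Ψ M (p + i - t) * (tauF q R F Ψ M t • (1 : Op N A 1))) := by
  induction i generalizing p with
  | zero =>
    rw [zero_add, qInt_one hq0 hq1, one_smul, Finset.sum_range_one, pow_zero, one_smul, add_zero,
      Nat.sub_zero, ← MpowF_mul_tauF hΨ hc hF (by omega : 1 + p + 0 = m)]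
    rfl
  | succ i ih =>
    rw [cayleyHamiltonNewton_step hq0 hq1 hqn hH hF hΨ hc hM (by omega), ih (by omega),
      Finset.sum_range_succ _ (i + 1), add_comm, Nat.add_sub_cancel, add_right_comm p 1 i]
    rfl

end Final

/-- Cayley–Hamilton–Newton identity, symmetric form, (28).
For a Hecke R-matrix `R̂` (with `m_q ≠ 0` for all `m ≥ 1`), a compatible closed
R-matrix `F̂`, and a matrix of generators `M` of `M(R̂,F̂)`:  for every `k = j+1 ≥ 1`,
`k_q M^{Sk} = ∑_{i=0}^{k−1} q^{−i} M^{\overline{k−i}} τ_i(M)`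
as `N×N` matrices over `A` (realized as one-site operators). -/
theorem CHN_symmetric {K : Type} [Field K] {A : Type} [Ring A] [Algebra K A]
    {N : ℕ} (q : K) (R F Ψ : M2 N K) (M : Matrix (Fin N) (Fin N) A)
    (hq0 : q ≠ 0) (hq1 : q ^ 2 ≠ 1) (hqn : ∀ n : ℕ, 1 ≤ n → qInt q n ≠ 0)
    (hH : IsHecke q R) (hF : IsUnit F) (hΨ : IsClosedPair F Ψ)
    (h : Compatible R F) (hM : IsGenerators R F M) :
    ∀ j : ℕ,
      (qInt q (j + 1)) • MsymF q R F Ψ M j =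
        ∑ i ∈ Finset.range (j + 1),
          ((q⁻¹) ^ i) •
            (MpowF R F Ψ M (j - i) * (tauF q R F Ψ M i • (1 : Op N A 1))) := by
  intro j
  have := cayleyHamiltonNewton_sum hq0 hq1 hqn hH hF hΨ h hM (by omega : 0 + j + 1 = 1 + j)
  simp only [kchain_zero, one_mul, Nat.zero_add] at this
  have e : copies (1 + j) F M 0 (j + 1) = copies (1 + j) F M 0 (1 + j) := by rw [add_comm j 1]
  rw [← this, MsymF, qtrs_eq_dn, qsym_map, ← e]
  rfl

end CHN
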